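/- arXiv:1701.06632 — 3 statements merged into one kernel-verified Lean document; each statement's English description precedes it below -/
import Mathlib

section
/- For any integers m, k ≥ 1 and any finite set system S, if f_S(m) ≤ (2^{k+1}−k−1)·m − 2^{4k}, then for all integers n ≥ m one has f_S(n) ≤ 2^{k+2} · m^{2k+2} · n^{k}. (In particular, t_k(m) > (2^{k+1}−k−1)m − 2^{4k}, where t_k(m) is the largest integer such that every set system S with f_S(m) ≤ t_k(m) satisfies f_S(n) = O(n^k).) -/
/-- The shatter function of a set system `S` on the finite ground set `X`:
`f_S(m) = max { |{e ∩ Y : e ∈ S}| : Y ⊆ X, |Y| = m }`. -/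
def shatter {X : Type*} [DecidableEq X] [Fintype X]
    (S : Finset (Finset X)) (m : ℕ) : ℕ :=
  (Finset.univ.powersetCard m).sup (fun Y => (S.image (· ∩ Y)).card)

namespace ShatterAux
open Finset

lemma compression_trace {X : Type*} [DecidableEq X] (a : X) (A : Finset (Finset X))
    (Y : Finset X) :
    (Down.compression a A).image (· ∩ Y) ⊆ Down.compression a (A.image (· ∩ Y)) := by
  intro s hs
  rw [mem_image] at hs
  obtain ⟨t, ht, rfl⟩ := hs
  rw [Down.mem_compression] at ht ⊢
  have he : ∀ t : Finset X, (t ∩ Y).erase a = t.erase a ∩ Y := by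
    intro t; rw [erase_inter]
  rcases ht with ⟨h1, h2⟩ | ⟨h1, h2⟩
  · left
    refine ⟨mem_image_of_mem _ h1, ?_⟩
    rw [he]
    exact mem_image_of_mem (· ∩ Y) h2
  · have hat : a ∉ t := by
      intro h
      rw [insert_eq_of_mem h] at h2
      exact h1 h2
    have hn : (t ∩ Y).erase a = t ∩ Y := by
      apply erase_eq_of_notMem
      simp [hat]
    by_cases h : t ∩ Y ∈ A.image (· ∩ Y)
    · left
      rw [hn]
      exact ⟨h, h⟩
    · right
      refine ⟨h, ?_⟩
      by_cases haY : a ∈ Y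
      · have : insert a (t ∩ Y) = insert a t ∩ Y := by
          rw [insert_inter_of_mem haY]
        rw [this]
        exact mem_image_of_mem (· ∩ Y) h2
      · exfalso
        apply h
        have : t ∩ Y = insert a t ∩ Y := by
          rw [insert_inter_of_notMem haY]
        rw [this]
        exact mem_image_of_mem (· ∩ Y) h2

lemma exists_compressed {X : Type*} [DecidableEq X] (A : Finset (Finset X)) (U : Finset X) :
    ∃ D : Finset (Finset X), D.card = A.card ∧
      (∀ Y : Finset X, (D.image (· ∩ Y)).card ≤ (A.image (· ∩ Y)).card) ∧
      ∀ b ∈ U, ∀ s ∈ D, s.erase b ∈ D := by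
  induction U using Finset.induction with
  | empty => exact ⟨A, rfl, fun _ => le_rfl, by simp⟩
  | insert a U ha ih =>
    obtain ⟨D, h1, h2, h3⟩ := ih
    refine ⟨Down.compression a D, by rw [Down.card_compression, h1], ?_, ?_⟩
    · intro Y
      calc _ ≤ (Down.compression a (D.image (· ∩ Y))).card :=
            card_le_card (compression_trace a D Y)
        _ = (D.image (· ∩ Y)).card := Down.card_compression _ _
        _ ≤ _ := h2 Y
    · intro b hb s hs
      rcases mem_insert.1 hb with rfl | hb
      · exact Down.erase_mem_compression_of_mem_compression hs
      · have hab : a ≠ b := fun h => ha (h ▸ hb)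
        rw [Down.mem_compression] at hs ⊢
        rcases hs with ⟨g1, g2⟩ | ⟨g1, g2⟩
        · left
          refine ⟨h3 b hb _ g1, ?_⟩
          rw [erase_right_comm]
          exact h3 b hb _ g2
        · have has : a ∉ s := by
            intro h
            rw [insert_eq_of_mem h] at g2
            exact g1 g2
          by_cases h : s.erase b ∈ D
          · left
            refine ⟨h, ?_⟩
            rw [erase_eq_of_notMem]
            · exact h
            · simp [has]
          · right
            refine ⟨h, ?_⟩
            have := h3 b hb _ g2
            rwa [erase_insert_of_ne hab] at this

/-- Down-compression: a downset of the same size with no larger traces. -/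
lemma exists_downset {X : Type*} [DecidableEq X] [Fintype X] (A : Finset (Finset X)) :
    ∃ D : Finset (Finset X), D.card = A.card ∧
      (∀ Y : Finset X, (D.filter (· ⊆ Y)).card ≤ (A.image (· ∩ Y)).card) ∧
      ∀ s ∈ D, ∀ t, t ⊆ s → t ∈ D := by
  obtain ⟨D, h1, h2, h3⟩ := exists_compressed A univ
  refine ⟨D, h1, ?_, ?_⟩
  · intro Y
    refine le_trans (card_le_card ?_) (h2 Y)
    intro s hs
    rw [mem_filter] at hs
    exact mem_image.2 ⟨s, hs.1, inter_eq_left.2 hs.2⟩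
  · intro s hs t hts
    have key : ∀ u : Finset X, s \ u ∈ D := by
      intro u
      induction u using Finset.induction with
      | empty => simpa using hs
      | insert a u _ ih =>
        have := h3 a (mem_univ _) _ ih
        rwa [← sdiff_insert] at this
    have := key (s \ t)
    rwa [Finset.sdiff_sdiff_eq_self hts] at this

lemma gibbs {ι : Type*} (s : Finset ι) (W V : ι → ℝ) (hW : ∀ i ∈ s, 0 ≤ W i)
    (hV : ∀ i ∈ s, 0 ≤ V i) (hsum : ∑ i ∈ s, W i = 1)
    (hWV : ∀ i ∈ s, W i ≠ 0 → 0 < V i) :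
    ∑ i ∈ s, W i * (Real.log (V i) - Real.log (W i)) ≤ Real.log (∑ i ∈ s, V i) := by
  set Z := ∑ i ∈ s, V i with hZ
  have hZpos : 0 < Z := by
    have : ∃ i ∈ s, W i ≠ 0 := by
      by_contra! h
      rw [sum_eq_zero h] at hsum
      exact zero_ne_one hsum
    obtain ⟨i, hi, hne⟩ := this
    exact sum_pos' hV ⟨i, hi, hWV i hi hne⟩
  have key : ∀ i ∈ s, W i * (Real.log (V i) - Real.log (W i)) ≤
      W i * Real.log Z + (V i / Z - W i) := by
    intro i hi
    by_cases h0 : W i = 0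
    · rw [h0]
      have := div_nonneg (hV i hi) hZpos.le
      simpa using this
    · have hw : 0 < W i := lt_of_le_of_ne (hW i hi) (Ne.symm h0)
      have hv := hWV i hi h0
      have h := Real.log_le_sub_one_of_pos (x := V i / (W i * Z)) (by positivity)
      rw [Real.log_div hv.ne' (by positivity), Real.log_mul hw.ne' hZpos.ne'] at h
      have h2 := mul_le_mul_of_nonneg_left h hw.le
      have h3 : W i * (V i / (W i * Z) - 1) = V i / Z - W i := by
        field_simp
      rw [h3] at h2
      linarith
  calc _ ≤ ∑ i ∈ s, (W i * Real.log Z + (V i / Z - W i)) := sum_le_sum key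
    _ = Real.log Z := by
      rw [sum_add_distrib, ← sum_mul, hsum, sum_sub_distrib, ← sum_div, ← hZ, hsum,
        div_self hZpos.ne']
      ring

lemma couple {A B : Type*} [Fintype A] [Fintype B]
    (μ : A → ℝ) (ν : B → ℝ) (hμ : ∀ a, 0 ≤ μ a) (hν : ∀ b, 0 ≤ ν b)
    (hμ1 : ∑ a, μ a = 1) (hν1 : ∑ b, ν b = 1) (bad : A → B → Prop)
    (h1 : ∀ a, ∀ s : Finset B, (∀ b ∈ s, bad a b) → ∑ b ∈ s, ν b ≤ 1 / 8)
    (h2 : ∀ b, ∀ s : Finset A, (∀ a ∈ s, bad a b) → ∑ a ∈ s, μ a ≤ 1 / 8) :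
    ∃ w : A → B → ℝ, (∀ a b, 0 ≤ w a b) ∧ (∀ a, ∑ b, w a b = μ a) ∧
      (∀ b, ∑ a, w a b = ν b) ∧ (∀ a b, bad a b → w a b = 0) ∧
      (∀ a b, w a b ≤ 4 * (μ a * ν b)) := by
  classical
  set K : Set (A → B → ℝ) := Set.Icc (fun _ _ => 0) (fun a b => 4 * (μ a * ν b)) ∩
    ({w | ∀ a, ∑ b, w a b = μ a} ∩ {w | ∀ b, ∑ a, w a b = ν b}) with hK
  have hKc : IsCompact K := by
    apply IsCompact.inter_right isCompact_Icc
    apply IsClosed.inter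
    · rw [Set.ofPred_forall]
      refine isClosed_iInter fun a => isClosed_eq (by fun_prop) (by fun_prop)
    · rw [Set.ofPred_forall]
      refine isClosed_iInter fun b => isClosed_eq (by fun_prop) (by fun_prop)
  have hKn : K.Nonempty := by
    refine ⟨fun a b => μ a * ν b, ⟨?_, ?_⟩, ?_, ?_⟩
    · intro a b; exact mul_nonneg (hμ a) (hν b)
    · intro a b
      have := mul_nonneg (hμ a) (hν b)
      simp only; linarith
    · intro a; simp only [← mul_sum, hν1, mul_one]
    · intro b; simp only [← sum_mul, hμ1, one_mul]
  obtain ⟨w, hwK, hmin⟩ := hKc.exists_isMinOn hKn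
    (f := fun w : A → B → ℝ => ∑ a, ∑ b, if bad a b then w a b else 0)
    (by
      apply Continuous.continuousOn
      refine continuous_finsetSum _ fun a _ => continuous_finsetSum _ fun b _ => ?_
      split_ifs <;> fun_prop)
  obtain ⟨⟨hw0, hwle⟩, hwr, hwc⟩ := hwK
  have hw0 : ∀ a b, 0 ≤ w a b := fun a b => hw0 a b
  have hwle : ∀ a b, w a b ≤ 4 * (μ a * ν b) := fun a b => hwle a b
  have hwr : ∀ a, ∑ b, w a b = μ a := hwr
  have hwc : ∀ b, ∑ a, w a b = ν b := hwc
  refine ⟨w, hw0, hwr, hwc, ?_, hwle⟩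
  intro a b hab
  by_contra hne
  have hpos : 0 < w a b := lt_of_le_of_ne (hw0 a b) (Ne.symm hne)
  have hμν : 0 < μ a * ν b := by have := hwle a b; linarith
  have hμa : 0 < μ a := by
    rcases (hμ a).eq_or_lt with h | h
    · rw [← h] at hμν; simp at hμν
    · exact h
  have hνb : 0 < ν b := by
    rcases (hν b).eq_or_lt with h | h
    · rw [← h] at hμν; simp at hμν
    · exact h
  have satB : ∑ b' ∈ univ.filter (fun b' => w a b' = 4 * (μ a * ν b')), ν b' ≤ 1 / 4 := by
    have : ∑ b' ∈ univ.filter (fun b' => w a b' = 4 * (μ a * ν b')), 4 * (μ a * ν b') ≤ μ a := by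
      refine le_trans ?_ (hwr a).le
      calc _ = ∑ b' ∈ univ.filter (fun b' => w a b' = 4 * (μ a * ν b')), w a b' :=
            sum_congr rfl fun b' hb' => (mem_filter.1 hb').2.symm
        _ ≤ _ := sum_le_sum_of_subset_of_nonneg (filter_subset _ _) fun _ _ _ => hw0 _ _
    rw [← mul_sum, ← mul_sum] at this
    nlinarith
  have satA : ∑ a' ∈ univ.filter (fun a' => w a' b = 4 * (μ a' * ν b)), μ a' ≤ 1 / 4 := by
    have : ∑ a' ∈ univ.filter (fun a' => w a' b = 4 * (μ a' * ν b)), 4 * (μ a' * ν b) ≤ ν b := by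
      refine le_trans ?_ (hwc b).le
      calc _ = ∑ a' ∈ univ.filter (fun a' => w a' b = 4 * (μ a' * ν b)), w a' b :=
            sum_congr rfl fun b' hb' => (mem_filter.1 hb').2.symm
        _ ≤ _ := sum_le_sum_of_subset_of_nonneg (filter_subset _ _) fun _ _ _ => hw0 _ _
    rw [← mul_sum, ← sum_mul] at this
    nlinarith
  have badB := h1 a (univ.filter (fun b' => bad a b')) (by simp)
  have badA := h2 b (univ.filter (fun a' => bad a' b)) (by simp)
  obtain ⟨a', b', hp, ga, sa, gb, sb⟩ : ∃ a' b', 0 < w a' b' ∧ ¬ bad a' b ∧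
      w a' b ≠ 4 * (μ a' * ν b) ∧ ¬ bad a b' ∧ w a b' ≠ 4 * (μ a * ν b') := by
    by_contra! hcon
    have hle : ∀ a' b', w a' b' ≤ (if bad a' b then w a' b' else 0) +
        (if w a' b = 4 * (μ a' * ν b) then w a' b' else 0) +
        ((if bad a b' then w a' b' else 0) +
        (if w a b' = 4 * (μ a * ν b') then w a' b' else 0)) := by
      intro a' b'
      have h0 := hw0 a' b'
      by_cases hp : 0 < w a' b'
      · by_cases q1 : bad a' b
        · rw [if_pos q1]; split_ifs <;> linarith
        by_cases q2 : w a' b = 4 * (μ a' * ν b)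
        · rw [if_pos q2]; split_ifs <;> linarith
        by_cases q3 : bad a b'
        · rw [if_pos q3]; split_ifs <;> linarith
        have q4 := hcon a' b' hp q1 q2 q3
        rw [if_pos q4]; split_ifs <;> linarith
      · have : w a' b' = 0 := le_antisymm (not_lt.1 hp) h0
        rw [this]; simp
    have hs : (1 : ℝ) ≤ 1 / 8 + 1 / 4 + (1 / 8 + 1 / 4) := by
      calc (1 : ℝ) = ∑ a', ∑ b', w a' b' := by rw [← hμ1]; simp [hwr]
        _ ≤ ∑ a', ∑ b', ((if bad a' b then w a' b' else 0) +
        (if w a' b = 4 * (μ a' * ν b) then w a' b' else 0) +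
        ((if bad a b' then w a' b' else 0) +
        (if w a b' = 4 * (μ a * ν b') then w a' b' else 0))) :=
          sum_le_sum fun a' _ => sum_le_sum fun b' _ => hle a' b'
        _ = ((∑ a', ∑ b', (if bad a' b then w a' b' else 0)) +
            (∑ a', ∑ b', (if w a' b = 4 * (μ a' * ν b) then w a' b' else 0))) +
            ((∑ b', ∑ a', (if bad a b' then w a' b' else 0)) +
            (∑ b', ∑ a', (if w a b' = 4 * (μ a * ν b') then w a' b' else 0))) := by
          rw [sum_comm (f := fun b' a' => if bad a b' then w a' b' else 0),
            sum_comm (f := fun b' a' => if w a b' = 4 * (μ a * ν b') then w a' b' else 0)]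
          simp only [sum_add_distrib]
        _ ≤ _ := by
          refine add_le_add (add_le_add ?_ ?_) (add_le_add ?_ ?_)
          · refine le_trans (le_of_eq ?_) badA
            rw [sum_filter]
            refine sum_congr rfl fun a' _ => ?_
            split_ifs <;> simp [hwr]
          · refine le_trans (le_of_eq ?_) satA
            rw [sum_filter]
            refine sum_congr rfl fun a' _ => ?_
            split_ifs <;> simp [hwr]
          · refine le_trans (le_of_eq ?_) badB
            rw [sum_filter]
            refine sum_congr rfl fun a' _ => ?_
            split_ifs <;> simp [hwc]
          · refine le_trans (le_of_eq ?_) satB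
            rw [sum_filter]
            refine sum_congr rfl fun a' _ => ?_
            split_ifs <;> simp [hwc]
    norm_num at hs
  have haa : a' ≠ a := by rintro rfl; exact ga hab
  have hbb : b' ≠ b := by rintro rfl; exact gb hab
  have sa' : w a' b < 4 * (μ a' * ν b) := lt_of_le_of_ne (hwle _ _) sa
  have sb' : w a b' < 4 * (μ a * ν b') := lt_of_le_of_ne (hwle _ _) sb
  obtain ⟨δ, hδ, d1, d2, d3, d4⟩ : ∃ δ : ℝ, 0 < δ ∧ δ ≤ w a b ∧ δ ≤ w a' b' ∧
      δ ≤ 4 * (μ a' * ν b) - w a' b ∧ δ ≤ 4 * (μ a * ν b') - w a b' := by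
    refine ⟨min (min (w a b) (w a' b')) (min (4 * (μ a' * ν b) - w a' b)
      (4 * (μ a * ν b') - w a b')), ?_, ?_, ?_, ?_, ?_⟩
    · refine lt_min (lt_min hpos hp) (lt_min ?_ ?_) <;> linarith
    · exact (min_le_left _ _).trans (min_le_left _ _)
    · exact (min_le_left _ _).trans (min_le_right _ _)
    · exact (min_le_right _ _).trans (min_le_left _ _)
    · exact (min_le_right _ _).trans (min_le_right _ _)
  set p : A → ℝ := fun s => (if s = a then 1 else 0) - (if s = a' then 1 else 0) with hpdef
  set q : B → ℝ := fun t => (if t = b' then 1 else 0) - (if t = b then 1 else 0) with hqdef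
  have hpsum : ∑ s, p s = 0 := by simp [hpdef, sum_sub_distrib]
  have hqsum : ∑ t, q t = 0 := by simp [hqdef, sum_sub_distrib]
  have hw'K : (fun s t => w s t + δ * (p s * q t)) ∈ K := by
    have hb : ∀ s t, 0 ≤ w s t + δ * (p s * q t) ∧
        w s t + δ * (p s * q t) ≤ 4 * (μ s * ν t) := by
      intro s t
      have e0 := hw0 s t
      have e1 := hwle s t
      simp only [hpdef, hqdef]
      by_cases s1 : s = a
      · subst s1
        by_cases t1 : t = b
        · subst t1
          simp only [if_true, haa.symm, hbb.symm, if_false]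
          constructor <;> linarith
        · by_cases t2 : t = b'
          · subst t2
            simp only [if_true, haa.symm, hbb, if_false]
            constructor <;> linarith
          · simp only [t1, t2, if_false]
            constructor <;> linarith
      · by_cases s2 : s = a'
        · subst s2
          by_cases t1 : t = b
          · subst t1
            simp only [if_true, haa, hbb.symm, if_false]
            constructor <;> linarith
          · by_cases t2 : t = b'
            · subst t2
              simp only [if_true, haa, hbb, if_false]
              constructor <;> linarith
            · simp only [t1, t2, if_false]
              constructor <;> linarith
        · simp only [s1, s2, if_false]
          constructor <;> linarith
    refine ⟨⟨fun s t => (hb s t).1, fun s t => (hb s t).2⟩, ?_, ?_⟩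
    · intro s
      simp only [sum_add_distrib, hwr, ← mul_sum, hqsum]
      ring
    · intro t
      simp only [sum_add_distrib, hwc, ← mul_sum, ← sum_mul, hpsum]
      ring
  have hm := hmin hw'K
  simp only [Set.mem_ofPred_eq] at hm
  have hcalc : ∑ s, ∑ t, (if bad s t then w s t + δ * (p s * q t) else 0) =
      ∑ s, ∑ t, (if bad s t then w s t else 0) +
      δ * (0 - 1 - (if bad a' b' then 1 else 0) + 0) := by
    have e1 : ∀ s t, (if bad s t then w s t + δ * (p s * q t) else 0) =
        (if bad s t then w s t else 0) + δ * (p s * (q t * (if bad s t then 1 else 0))) := by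
      intro s t; split_ifs <;> ring
    simp only [e1, sum_add_distrib, ← mul_sum]
    congr 2
    simp only [hpdef, hqdef, sub_mul, sum_sub_distrib, ite_mul, one_mul, zero_mul,
      sum_ite_eq', mem_univ, if_true, gb, ga, hab, if_false]
    ring
  rw [hcalc] at hm
  have : (0 : ℝ) ≤ (if bad a' b' then 1 else 0) := by split_ifs <;> norm_num
  nlinarith

lemma couple_many {L : Type*} [Fintype L] [DecidableEq L] [Nonempty L] (bad : L → L → Prop)
    (hsymm : ∀ l l', bad l l' → bad l' l) (j : ℕ)
    (h : ∀ l, ∀ s : Finset L, (∀ l' ∈ s, bad l l') →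
      8 * (j : ℝ) * (s.card : ℝ) ≤ Fintype.card L) :
    ∃ W : (Fin j → L) → ℝ, (∀ t, 0 ≤ W t) ∧ ∑ t, W t = 1 ∧
      (∀ i, ∀ g : L → ℝ, ∑ t, W t * g (t i) = (∑ l, g l) / Fintype.card L) ∧
      (∀ t, W t ≠ 0 → ∀ i i', i ≠ i' → ¬ bad (t i) (t i')) ∧
      (∀ t, W t ≤ (4 / Fintype.card L) ^ j) := by
  have hd : (0 : ℝ) < Fintype.card L := by exact_mod_cast Fintype.card_pos
  induction j with
  | zero =>
    exact ⟨fun _ => 1, by simp, by simp, fun i => i.elim0, fun _ _ i => i.elim0, by simp⟩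
  | succ j ih =>
    obtain ⟨W, hW0, hW1, hWm, hWb, hWle⟩ := ih (by
      intro l s hs
      refine le_trans ?_ (h l s hs)
      push_cast
      have : (0 : ℝ) ≤ s.card := by positivity
      nlinarith)
    classical
    obtain ⟨w, g0, gr, gc, gb, gle⟩ := couple W (fun _ : L => 1 / (Fintype.card L : ℝ)) hW0
      (fun _ => by positivity) hW1 (by simp [hd.ne'])
      (fun t l => ∃ i, bad (t i) l) (by
        intro t s hs
        have hle : s.card ≤ ∑ i : Fin j, (s.filter (fun l => bad (t i) l)).card := by
          refine le_trans (card_le_card ?_) card_biUnion_le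
          intro l hl
          obtain ⟨i, hi⟩ := hs l hl
          exact mem_biUnion.2 ⟨i, mem_univ _, mem_filter.2 ⟨hl, hi⟩⟩
        have hle' : (s.card : ℝ) ≤ ∑ i : Fin j, ((s.filter (fun l => bad (t i) l)).card : ℝ) := by
          exact_mod_cast hle
        rw [sum_const, nsmul_eq_mul, mul_one_div, div_le_div_iff₀ hd (by norm_num)]
        have h3 : (8 * ((j + 1 : ℕ) : ℝ)) * s.card ≤ j * Fintype.card L := by
          calc _ ≤ (8 * ((j + 1 : ℕ) : ℝ)) *
                ∑ i : Fin j, ((s.filter (fun l => bad (t i) l)).card : ℝ) := by gcongr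
            _ = ∑ i : Fin j, (8 * ((j + 1 : ℕ) : ℝ)) * ((s.filter (fun l => bad (t i) l)).card : ℝ) :=
              mul_sum _ _ _
            _ ≤ ∑ i : Fin j, (Fintype.card L : ℝ) :=
              sum_le_sum fun i _ => h (t i) _ (by simp)
            _ = _ := by simp
        push_cast at h3
        have hj : (0 : ℝ) ≤ j := by positivity
        by_contra! hc
        nlinarith) (by
        intro l s hs
        have e1 : ∑ t ∈ s, W t ≤ ∑ i : Fin j, ∑ t, W t * (if bad (t i) l then 1 else 0) := by
          rw [sum_comm]
          calc _ ≤ ∑ t ∈ s, ∑ i : Fin j, W t * (if bad (t i) l then 1 else 0) := by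
                refine sum_le_sum fun t ht => ?_
                obtain ⟨i, hi⟩ := hs t ht
                refine le_trans (le_of_eq ?_) (single_le_sum (f := fun i : Fin j =>
                  W t * (if bad (t i) l then 1 else 0)) ?_ (mem_univ i))
                · simp [hi]
                · intro i _
                  exact mul_nonneg (hW0 t) (by split_ifs <;> norm_num)
            _ ≤ _ := by
                refine sum_le_sum_of_subset_of_nonneg (subset_univ _) fun t _ _ =>
                  sum_nonneg fun i _ => mul_nonneg (hW0 t) (by split_ifs <;> norm_num)
        have e2 : ∀ i : Fin j, ∑ t, W t * (if bad (t i) l then (1 : ℝ) else 0) =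
            ((univ.filter (fun l' => bad l' l)).card : ℝ) / Fintype.card L := by
          intro i
          rw [hWm i (fun l' => if bad l' l then (1 : ℝ) else 0)]
          simp
        simp only [e2, sum_const, card_univ, Fintype.card_fin, nsmul_eq_mul] at e1
        refine e1.trans ?_
        have h3 := h l (univ.filter (fun l' => bad l' l)) (by
          intro l' hl'; exact hsymm _ _ (mem_filter.1 hl').2)
        rw [mul_div_assoc', div_le_div_iff₀ hd (by norm_num)]
        push_cast at h3
        have : (0 : ℝ) ≤ ((univ.filter (fun l' => bad l' l)).card : ℝ) := by positivity
        nlinarith)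
    have hsum : ∀ F : (Fin (j + 1) → L) → ℝ,
        ∑ t, F t = ∑ t : Fin j → L, ∑ l : L, F (Fin.cons l t) := by
      intro F
      rw [← (Fin.consEquiv (fun _ => L)).sum_comp, Fintype.sum_prod_type, sum_comm]
      rfl
    refine ⟨fun t => w (Fin.tail t) (t 0), fun t => g0 _ _, ?_, ?_, ?_, ?_⟩
    · rw [hsum]
      simp [gr, hW1]
    · intro i g
      rw [hsum]
      simp only [Fin.tail_cons, Fin.cons_zero]
      refine Fin.cases ?_ (fun i => ?_) i
      · simp only [Fin.cons_zero]
        rw [sum_comm]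
        simp only [← sum_mul, gc]
        rw [← mul_sum]
        field_simp
      · simp only [Fin.cons_succ, ← sum_mul, gr]
        exact hWm i g
    · intro t ht i i' hii
      have hgood : ∀ i : Fin j, ¬ bad (t i.succ) (t 0) := by
        intro i hi
        exact ht (gb _ _ ⟨i, hi⟩)
      have hWt : W (Fin.tail t) ≠ 0 := by
        intro h0
        apply ht
        have := gle (Fin.tail t) (t 0)
        rw [h0] at this
        exact le_antisymm (by simpa using this) (g0 _ _)
      have hb := hWb _ hWt
      induction i using Fin.cases with
      | zero =>
        induction i' using Fin.cases with
        | zero => exact absurd rfl hii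
        | succ i' => exact fun hc => hgood i' (hsymm _ _ hc)
      | succ i =>
        induction i' using Fin.cases with
        | zero => exact hgood i
        | succ i' => exact hb i i' (fun hc => hii (by rw [hc]))
    · intro t
      refine (gle _ _).trans ?_
      rw [pow_succ]
      have := hWle (Fin.tail t)
      calc _ ≤ 4 * ((4 / (Fintype.card L : ℝ)) ^ j * (1 / (Fintype.card L : ℝ))) := by gcongr
        _ = _ := by ring

lemma zbound {T : Type*} [DecidableEq T] (Ex : Finset T) (hd : 0 < Ex.card)
    (bad : T → T → Prop) (hsymm : ∀ l l', bad l l' → bad l' l) (k : ℕ)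
    (h : ∀ l ∈ Ex, ∀ s ⊆ Ex, (∀ l' ∈ s, bad l l') → 8 * k * s.card ≤ Ex.card)
    (u : Fin k → T → ℝ) (hu : ∀ i, ∀ l ∈ Ex, 0 < u i l)
    [DecidablePred (fun t : Fin k → T => ∀ i i', i ≠ i' → ¬ bad (t i) (t i'))] :
    0 < ∑ t ∈ (Fintype.piFinset (fun _ : Fin k => Ex)).filter
      (fun t => ∀ i i', i ≠ i' → ¬ bad (t i) (t i')), ∏ i, u i (t i) ∧
    ∑ i, ∑ l ∈ Ex, Real.log (u i l) + Ex.card * (k * (Real.log Ex.card - Real.log 4)) ≤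
      Ex.card * Real.log (∑ t ∈ (Fintype.piFinset (fun _ : Fin k => Ex)).filter
      (fun t => ∀ i i', i ≠ i' → ¬ bad (t i) (t i')), ∏ i, u i (t i)) := by
  classical
  have : Nonempty Ex := (card_pos.1 hd).to_subtype
  obtain ⟨W, hW0, hW1, hWm, hWb, hWle⟩ := couple_many (L := Ex) (fun l l' => bad l l')
    (fun l l' hb => hsymm _ _ hb) k (by
      intro l s hs
      have := h l l.2 (s.map (Function.Embedding.subtype _)) (by
        intro y hy
        obtain ⟨z, _, rfl⟩ := mem_map.1 hy
        exact z.2) (by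
        intro y hy
        obtain ⟨z, hz, rfl⟩ := mem_map.1 hy
        exact hs z hz)
      rw [card_map] at this
      rw [Fintype.card_coe]
      exact_mod_cast this)
  rw [Fintype.card_coe] at hWm hWle
  set V : (Fin k → Ex) → ℝ := fun t => ∏ i, u i (t i) with hV
  have hVpos : ∀ t, 0 < V t := fun t => prod_pos fun i _ => hu i _ (t i).2
  have hZ : ∑ t ∈ (Fintype.piFinset (fun _ : Fin k => Ex)).filter
      (fun t => ∀ i i', i ≠ i' → ¬ bad (t i) (t i')), ∏ i, u i (t i) =
      ∑ t ∈ univ.filter (fun t : Fin k → Ex => ∀ i i', i ≠ i' → ¬ bad (t i) (t i')), V t := by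
    symm
    refine sum_bij (fun t _ i => (t i : T)) ?_ ?_ ?_ ?_
    · intro t ht
      simp only [mem_filter, mem_univ, true_and] at ht
      simp only [mem_filter, Fintype.mem_piFinset]
      exact ⟨fun i => (t i).2, ht⟩
    · intro t _ t' _ htt
      funext i
      exact Subtype.ext (congrFun htt i)
    · intro t ht
      simp only [mem_filter, Fintype.mem_piFinset] at ht
      exact ⟨fun i => ⟨t i, ht.1 i⟩, by simpa using ht.2, rfl⟩
    · intro t _; rfl
  rw [hZ]
  set G := univ.filter (fun t : Fin k → Ex => ∀ i i', i ≠ i' → ¬ bad (t i) (t i')) with hG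
  have hWG : ∀ t, t ∉ G → W t = 0 := by
    intro t ht
    by_contra h0
    exact ht (mem_filter.2 ⟨mem_univ _, hWb t h0⟩)
  have hWsum : ∀ F : (Fin k → Ex) → ℝ, ∑ t ∈ G, W t * F t = ∑ t, W t * F t := by
    intro F
    exact sum_subset (subset_univ _) fun t _ ht => by rw [hWG t ht, zero_mul]
  have hGsum : ∑ t ∈ G, W t = 1 := by
    rw [← hW1]
    exact sum_subset (subset_univ _) fun t _ ht => hWG t ht
  have hg := gibbs G W V (fun t _ => hW0 t) (fun t _ => (hVpos t).le) hGsum (fun t _ _ => hVpos t)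
  have hdR : (0 : ℝ) < Ex.card := by exact_mod_cast hd
  refine ⟨sum_pos (fun t _ => hVpos t) ?_, ?_⟩
  · by_contra hne
    rw [not_nonempty_iff_eq_empty] at hne
    rw [hne] at hGsum
    simp at hGsum
  have hlow : ∑ t ∈ G, W t * (Real.log (V t) + k * (Real.log Ex.card - Real.log 4)) ≤
      ∑ t ∈ G, W t * (Real.log (V t) - Real.log (W t)) := by
    refine sum_le_sum fun t _ => ?_
    by_cases h0 : W t = 0
    · simp [h0]
    refine mul_le_mul_of_nonneg_left ?_ (hW0 t)
    have := Real.log_le_log (lt_of_le_of_ne (hW0 t) (Ne.symm h0)) (hWle t)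
    rw [Real.log_pow, Real.log_div (by norm_num) hdR.ne'] at this
    linarith
  rw [hWsum] at hlow
  have e1 : ∑ t, W t * (Real.log (V t) + k * (Real.log Ex.card - Real.log 4)) =
      (∑ i, ∑ l ∈ Ex, Real.log (u i l)) / Ex.card + k * (Real.log Ex.card - Real.log 4) := by
    simp only [mul_add, sum_add_distrib, ← sum_mul, hW1, one_mul]
    congr 1
    calc ∑ t, W t * Real.log (V t) = ∑ t, ∑ i, W t * Real.log (u i (t i)) := by
          refine sum_congr rfl fun t _ => ?_
          rw [hV, Real.log_prod (fun i _ => (hu i _ (t i).2).ne'), mul_sum]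
      _ = ∑ i, ∑ t, W t * Real.log (u i (t i)) := sum_comm
      _ = ∑ i, (∑ l ∈ Ex, Real.log (u i l)) / Ex.card := by
          refine sum_congr rfl fun i _ => ?_
          rw [hWm i (fun l => Real.log (u i l)), ← sum_coe_sort Ex (fun l => Real.log (u i l))]
      _ = _ := by rw [sum_div]
  rw [e1] at hlow
  have h5 := hlow.trans hg
  have h6 := mul_le_mul_of_nonneg_left h5 hdR.le
  rw [mul_add, mul_div_cancel₀ _ hdR.ne'] at h6
  exact h6

/-- Agreement of two tuples on coordinates `1, …, i+1`. -/
def Agr {X : Type*} {k : ℕ} (i : Fin k) (l l' : Fin (k + 1) → X) : Prop :=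
  ∀ a : Fin k, a ≤ i → l a.succ = l' a.succ

/-- The tails of two tuples share a vertex. -/
def Meet {X : Type*} {k : ℕ} (l l' : Fin (k + 1) → X) : Prop :=
  ∃ a b : Fin k, l a.succ = l' b.succ

open Classical in
set_option maxHeartbeats 1000000 in
lemma zsum {X : Type*} [Fintype X] {k : ℕ} (E : Finset (Fin (k + 1) → X)) (V : Finset X)
    (hE : 0 < E.card) (M : ℕ)
    (hM : ∀ e' : Fin k → Fin (k + 1) → X,
      (∀ i, e' i ∈ E) →
      (∀ i i', i ≠ i' → ∀ a b, a ≤ i → b ≤ i' → e' i a.succ ≠ e' i' b.succ) →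
      (V.filter (fun x => ∀ i, ∃ e ∈ E, e 0 = x ∧ Agr i e (e' i))).card ≤ M) :
    ∑ x ∈ V, ∑ t ∈ (Fintype.piFinset (fun _ : Fin k => E.filter (fun e => e 0 = x))).filter
      (fun t => ∀ i i', i ≠ i' → ¬ Meet (t i) (t i')),
      ∏ i, (((E.filter (fun e' => Agr i e' (t i))).card : ℝ) /
        (E.card * (E.filter (fun e' => e' 0 = t i 0 ∧ Agr i e' (t i))).card)) ≤ M := by
  have hN : (0 : ℝ) < E.card := by exact_mod_cast hE
  set c : Fin k → (Fin (k + 1) → X) → ℝ :=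
    fun i l => ((E.filter (fun e' => e' 0 = l 0 ∧ Agr i e' l)).card : ℝ) with hc
  set q : Fin k → (Fin (k + 1) → X) → (Fin (k + 1) → X) → ℝ :=
    fun i l e' => if Agr i e' l then 1 / c i l else 0 with hq
  have hq0 : ∀ i l e', 0 ≤ q i l e' := by
    intro i l e'
    simp only [hq]
    split_ifs <;> positivity
  have hexp : ∀ t : Fin k → Fin (k + 1) → X,
      ∏ i, (((E.filter (fun e' => Agr i e' (t i))).card : ℝ) /
        (E.card * (E.filter (fun e' => e' 0 = t i 0 ∧ Agr i e' (t i))).card)) =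
      (1 / (E.card : ℝ) ^ k) *
        ∑ e' ∈ Fintype.piFinset (fun _ : Fin k => E), ∏ i, q i (t i) (e' i) := by
    intro t
    change ∏ i, (((E.filter (fun e' => Agr i e' (t i))).card : ℝ) / (E.card * c i (t i))) = _
    rw [← prod_univ_sum (fun _ : Fin k => E) (fun i e => q i (t i) e)]
    have : (1 / (E.card : ℝ) ^ k) = ∏ _i : Fin k, (1 / (E.card : ℝ)) := by simp
    rw [this, ← prod_mul_distrib]
    refine prod_congr rfl fun i _ => ?_
    simp only [hq]
    rw [← sum_filter, sum_const, nsmul_eq_mul, mul_one_div, mul_comm (E.card : ℝ), ← div_div]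
    ring
  simp only [hexp, ← mul_sum]
  have hsw : ∀ x : X, ∑ t ∈ (Fintype.piFinset (fun _ : Fin k => E.filter (fun e => e 0 = x))).filter
      (fun t => ∀ i i', i ≠ i' → ¬ Meet (t i) (t i')),
      ∑ e' ∈ Fintype.piFinset (fun _ : Fin k => E), ∏ i, q i (t i) (e' i) =
      ∑ e' ∈ Fintype.piFinset (fun _ : Fin k => E),
      ∑ t ∈ (Fintype.piFinset (fun _ : Fin k => E.filter (fun e => e 0 = x))).filter
      (fun t => ∀ i i', i ≠ i' → ¬ Meet (t i) (t i')), ∏ i, q i (t i) (e' i) :=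
    fun x => sum_comm
  simp only [hsw]
  rw [sum_comm]
  have hmain : ∀ e' ∈ Fintype.piFinset (fun _ : Fin k => E),
      ∑ x ∈ V, ∑ t ∈ (Fintype.piFinset (fun _ : Fin k => E.filter (fun e => e 0 = x))).filter
      (fun t => ∀ i i', i ≠ i' → ¬ Meet (t i) (t i')), ∏ i, q i (t i) (e' i) ≤ (M : ℝ) := by
    intro e' he'
    rw [Fintype.mem_piFinset] at he'
    have hzero : ∀ x, ∀ t ∈ (Fintype.piFinset (fun _ : Fin k => E.filter (fun e => e 0 = x))).filter
      (fun t => ∀ i i', i ≠ i' → ¬ Meet (t i) (t i')), ∏ i, q i (t i) (e' i) ≠ 0 →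
        (∀ i i', i ≠ i' → ∀ a b, a ≤ i → b ≤ i' → e' i a.succ ≠ e' i' b.succ) ∧
        (∀ i, ∃ e ∈ E, e 0 = x ∧ Agr i e (e' i)) := by
      intro x t ht hne
      simp only [mem_filter, Fintype.mem_piFinset] at ht
      have hag : ∀ i, Agr i (e' i) (t i) := by
        intro i
        by_contra hcon
        apply hne
        refine prod_eq_zero (mem_univ i) ?_
        simp only [hq, if_neg hcon]
      refine ⟨?_, ?_⟩
      · intro i i' hii a b ha hb heq
        apply ht.2 i i' hii
        exact ⟨a, b, by rw [← hag i a ha, ← hag i' b hb, heq]⟩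
      · intro i
        exact ⟨t i, (ht.1 i).1, (ht.1 i).2, fun a ha => (hag i a ha).symm⟩
    by_cases hdis : ∀ i i', i ≠ i' → ∀ a b, a ≤ i → b ≤ i' → e' i a.succ ≠ e' i' b.succ
    · refine le_trans ?_ (Nat.cast_le.2 (hM e' he' hdis))
      rw [card_filter]
      push_cast
      refine sum_le_sum fun x _ => ?_
      split_ifs with hx
      · calc _ ≤ ∑ t ∈ Fintype.piFinset (fun _ : Fin k => E.filter (fun e => e 0 = x)),
              ∏ i, q i (t i) (e' i) :=
              sum_le_sum_of_subset_of_nonneg (filter_subset _ _)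
                fun t _ _ => prod_nonneg fun i _ => hq0 _ _ _
          _ = ∏ i, ∑ l ∈ E.filter (fun e => e 0 = x), q i l (e' i) :=
              by rw [prod_univ_sum]
          _ ≤ ∏ _i : Fin k, (1 : ℝ) := by
              refine prod_le_prod (fun i _ => sum_nonneg fun l _ => hq0 _ _ _) fun i _ => ?_
              simp only [hq]
              rw [← sum_filter, filter_filter]
              have : ∀ l ∈ E.filter (fun e => e 0 = x ∧ Agr i (e' i) e),
                  1 / c i l = 1 / ((E.filter (fun e => e 0 = x ∧ Agr i (e' i) e)).card : ℝ) := by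
                intro l hl
                simp only [mem_filter] at hl
                simp only [hc]
                congr 3
                ext e
                simp only [mem_filter]
                refine and_congr_right fun _ => ?_
                rw [hl.2.1]
                refine and_congr_right fun _ => ?_
                constructor
                · intro h a ha
                  rw [hl.2.2 a ha, h a ha]
                · intro h a ha
                  rw [← h a ha, hl.2.2 a ha]
              rw [sum_congr rfl this, sum_const, nsmul_eq_mul]
              rw [mul_one_div]; exact div_self_le_one _
          _ = 1 := by simp
      · refine le_of_eq (sum_eq_zero fun t ht => ?_)
        by_contra hne
        exact hx (hzero x t ht hne).2
    · refine le_trans (le_of_eq (sum_eq_zero fun x _ => sum_eq_zero fun t ht => ?_)) (Nat.cast_nonneg M)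
      by_contra hne
      exact hdis (hzero x t ht hne).1
  calc _ ≤ (1 / (E.card : ℝ) ^ k) * ∑ e' ∈ Fintype.piFinset (fun _ : Fin k => E), (M : ℝ) := by
        refine mul_le_mul_of_nonneg_left (sum_le_sum hmain) (by positivity)
    _ = M := by
        rw [sum_const, Fintype.card_piFinset]
        simp
        field_simp

open Classical in
set_option maxHeartbeats 1000000 in
lemma entropy {X : Type*} [Fintype X] {k : ℕ} (E : Finset (Fin (k + 1) → X)) (V : Finset X)
    (n M : ℕ) (hn : V.card ≤ n)
    (hEV : ∀ e ∈ E, e 0 ∈ V)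
    (hrot : ∀ e, e ∈ E ↔ e ∘ finRotate (k + 1) ∈ E)
    (hbad : ∀ e ∈ E, 8 * k * (E.filter (fun e' => e' 0 = e 0 ∧ Meet e e')).card ≤
      (E.filter (fun e' => e' 0 = e 0)).card)
    (hM : ∀ e' : Fin k → Fin (k + 1) → X,
      (∀ i, e' i ∈ E) →
      (∀ i i', i ≠ i' → ∀ a b, a ≤ i → b ≤ i' → e' i a.succ ≠ e' i' b.succ) →
      (V.filter (fun x => ∀ i, ∃ e ∈ E, e 0 = x ∧ Agr i e (e' i))).card ≤ M) :
    E.card ≤ 4 ^ k * M * n ^ k := by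
  rcases Nat.eq_zero_or_pos E.card with hE | hE
  · rw [hE]; exact Nat.zero_le _
  have hN : (0 : ℝ) < E.card := by exact_mod_cast hE
  set g : ℕ → (Fin (k + 1) → X) → ℕ :=
    fun j e => (E.filter (fun e' => ∀ a : Fin (k + 1), a.val < j → e' a = e a)).card with hg
  set H : ℕ → ℝ := fun j => ∑ e ∈ E, Real.log (g j e) with hH
  have hgpos : ∀ j, ∀ e ∈ E, 0 < g j e := fun j e he =>
    card_pos.2 ⟨e, mem_filter.2 ⟨he, fun _ _ => rfl⟩⟩
  have hg1 : ∀ e, (E.filter (fun e' => e' 0 = e 0)).card = g 1 e := by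
    intro e
    simp only [hg]
    congr 1
    ext e'
    simp only [mem_filter]
    refine and_congr_right fun _ => ⟨fun h a ha => ?_, fun h => h 0 (by simp)⟩
    have : a = 0 := by
      apply Fin.ext
      change a.val = 0
      omega
    rw [this, h]
  have hg2 : ∀ (i : Fin k) e, (E.filter (fun e' => e' 0 = e 0 ∧ Agr i e' e)).card =
      g (i.val + 2) e := by
    intro i e
    simp only [hg]
    congr 1
    ext e'
    simp only [mem_filter]
    refine and_congr_right fun _ => ⟨fun h a ha => ?_, fun h => ⟨h 0 (by simp), fun a ha => ?_⟩⟩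
    · induction a using Fin.cases with
      | zero => exact h.1
      | succ a =>
        refine h.2 a ?_
        rw [Fin.val_succ] at ha
        rw [Fin.le_def]; omega
    · refine h _ ?_
      rw [Fin.val_succ]
      rw [Fin.le_def] at ha; omega
  have hg3 : ∀ e ∈ E, g (k + 1) e = 1 := by
    intro e he
    simp only [hg]
    rw [card_eq_one]
    refine ⟨e, ?_⟩
    ext e'
    simp only [mem_filter, mem_singleton]
    constructor
    · rintro ⟨_, h⟩
      funext a
      exact h a a.2
    · rintro rfl
      exact ⟨he, fun _ _ => rfl⟩
  have hHk : H (k + 1) = 0 := by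
    simp only [hH]
    refine sum_eq_zero fun e he => ?_
    rw [hg3 e he]; simp
  have hrotc : ∀ (a : Fin k) (e : Fin (k + 1) → X), (e ∘ finRotate (k + 1)) a.castSucc = e a.succ := by
    intro a e
    simp [Function.comp]
  have hbij : ∀ P : (Fin (k + 1) → X) → Prop,
      (E.filter (fun e => P (e ∘ finRotate (k + 1)))).card = (E.filter P).card := by
    intro P
    refine card_bij (fun e _ => e ∘ finRotate (k + 1)) ?_ ?_ ?_
    · intro e he
      rw [mem_filter] at he ⊢
      exact ⟨(hrot e).1 he.1, he.2⟩
    · intro e _ e' _ h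
      exact (finRotate (k + 1)).surjective.injective_comp_right h
    · intro e he
      rw [mem_filter] at he
      have h1 : (e ∘ (finRotate (k + 1)).symm) ∘ finRotate (k + 1) = e := by
        funext a; simp
      refine ⟨e ∘ (finRotate (k + 1)).symm, ?_, h1⟩
      rw [mem_filter, hrot, h1]
      exact he
  have hgr : ∀ (i : Fin k) e, (E.filter (fun e' => Agr i e' e)).card =
      g (i.val + 1) (e ∘ finRotate (k + 1)) := by
    intro i e
    simp only [hg]
    refine Eq.trans ?_ ((hbij (fun e' => ∀ a : Fin (k + 1), a.val < i.val + 1 →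
      e' a = (e ∘ finRotate (k + 1)) a)).trans (by congr))
    congr 1
    ext e'
    simp only [mem_filter]
    refine and_congr_right fun _ => ⟨fun h a ha => ?_, fun h a ha => ?_⟩
    · obtain ⟨a, rfl⟩ : ∃ b : Fin k, a = b.castSucc := ⟨⟨a.val, by omega⟩, rfl⟩
      rw [hrotc, hrotc]
      refine h a ?_
      rw [Fin.val_castSucc] at ha
      rw [Fin.le_def]; omega
    · have := h a.castSucc (by rw [Fin.val_castSucc]; rw [Fin.le_def] at ha; omega)
      rwa [hrotc, hrotc] at this
  have hHr : ∀ i : Fin k, ∑ e ∈ E, Real.log ((E.filter (fun e' => Agr i e' e)).card) =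
      H (i.val + 1) := by
    intro i
    simp only [hH]
    refine sum_bij (fun e _ => e ∘ finRotate (k + 1)) ?_ ?_ ?_ ?_
    · intro e he
      exact (hrot e).1 he
    · intro e _ e' _ h
      exact (finRotate (k + 1)).surjective.injective_comp_right h
    · intro e he
      have h1 : (e ∘ (finRotate (k + 1)).symm) ∘ finRotate (k + 1) = e := by
        funext a; simp
      refine ⟨e ∘ (finRotate (k + 1)).symm, ?_, h1⟩
      rw [hrot, h1]
      exact he
    · intro e _
      rw [hgr]
  set u : Fin k → (Fin (k + 1) → X) → ℝ := fun i l =>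
    (((E.filter (fun e' => Agr i e' l)).card : ℝ) /
        (E.card * (E.filter (fun e' => e' 0 = l 0 ∧ Agr i e' l)).card)) with hu
  have hupos : ∀ i, ∀ e ∈ E, 0 < u i e := by
    intro i e he
    simp only [hu]
    have h1 : 0 < (E.filter (fun e' => Agr i e' e)).card :=
      card_pos.2 ⟨e, mem_filter.2 ⟨he, fun _ _ => rfl⟩⟩
    have h2 : 0 < (E.filter (fun e' => e' 0 = e 0 ∧ Agr i e' e)).card :=
      card_pos.2 ⟨e, mem_filter.2 ⟨he, rfl, fun _ _ => rfl⟩⟩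
    have h1' : (0 : ℝ) < (E.filter (fun e' => Agr i e' e)).card := by exact_mod_cast h1
    have h2' : (0 : ℝ) < (E.filter (fun e' => e' 0 = e 0 ∧ Agr i e' e)).card := by
      exact_mod_cast h2
    exact div_pos h1' (mul_pos hN h2')
  have hlogu : ∀ i, ∀ e ∈ E, Real.log (u i e) =
      Real.log ((E.filter (fun e' => Agr i e' e)).card) - Real.log E.card -
        Real.log (g (i.val + 2) e) := by
    intro i e he
    have h1 : 0 < (E.filter (fun e' => Agr i e' e)).card :=
      card_pos.2 ⟨e, mem_filter.2 ⟨he, fun _ _ => rfl⟩⟩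
    have h1' : (0 : ℝ) < (E.filter (fun e' => Agr i e' e)).card := by exact_mod_cast h1
    have h2' : (0 : ℝ) < g (i.val + 2) e := by exact_mod_cast hgpos _ e he
    simp only [hu]
    rw [hg2, Real.log_div h1'.ne' (mul_pos hN h2').ne', Real.log_mul hN.ne' h2'.ne']
    ring
  set Ex : X → Finset (Fin (k + 1) → X) := fun x => E.filter (fun e => e 0 = x) with hEx
  set Z : X → ℝ := fun x => ∑ t ∈ (Fintype.piFinset (fun _ : Fin k => Ex x)).filter
      (fun t => ∀ i i', i ≠ i' → ¬ Meet (t i) (t i')), ∏ i, u i (t i) with hZ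
  have hZsum : ∑ x ∈ V, Z x ≤ M := zsum E V hE M hM
  set V' := V.filter (fun x => 0 < (Ex x).card) with hV'
  have hEV' : ∀ e ∈ E, e 0 ∈ V' := fun e he =>
    mem_filter.2 ⟨hEV e he, card_pos.2 ⟨e, mem_filter.2 ⟨he, rfl⟩⟩⟩
  have hfib : ∀ F : (Fin (k + 1) → X) → ℝ, ∑ x ∈ V', ∑ e ∈ Ex x, F e = ∑ e ∈ E, F e :=
    fun F => sum_fiberwise_of_maps_to hEV' F
  have hZx : ∀ x ∈ V', 0 < Z x ∧
      ∑ i, ∑ l ∈ Ex x, Real.log (u i l) +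
        (Ex x).card * (k * (Real.log (Ex x).card - Real.log 4)) ≤
      (Ex x).card * Real.log (Z x) := by
    intro x hx
    refine zbound (Ex x) (mem_filter.1 hx).2 Meet ?_ k ?_ u ?_
    · rintro l l' ⟨a, b, h⟩
      exact ⟨b, a, h.symm⟩
    · intro l hl s hs hb
      have hl' := mem_filter.1 hl
      have := hbad l hl'.1
      rw [hl'.2] at this
      refine le_trans ?_ this
      gcongr
      intro e he
      have h1 := mem_filter.1 (hs he)
      exact mem_filter.2 ⟨h1.1, h1.2, hb e he⟩
    · intro i l hl
      exact hupos i l (mem_filter.1 hl).1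
  have hZ0 : ∀ x, 0 ≤ Z x := by
    intro x
    refine sum_nonneg fun t _ => prod_nonneg fun i _ => ?_
    exact div_nonneg (Nat.cast_nonneg _) (mul_nonneg hN.le (Nat.cast_nonneg _))
  have hZV' : ∑ x ∈ V', Z x ≤ M :=
    (sum_le_sum_of_subset_of_nonneg (filter_subset _ _) fun x _ _ => hZ0 x).trans hZsum
  obtain ⟨e0, he0⟩ := card_pos.1 hE
  have hZpos : 0 < ∑ x ∈ V', Z x := sum_pos (fun x hx => (hZx x hx).1) ⟨_, hEV' e0 he0⟩
  have hMpos : (0 : ℝ) < M := lt_of_lt_of_le hZpos hZV'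
  have hdpos : ∀ x ∈ V', (0 : ℝ) < (Ex x).card := fun x hx => by
    exact_mod_cast (mem_filter.1 hx).2
  have hd1 : ∑ x ∈ V', ((Ex x).card : ℝ) = E.card := by
    have := hfib (fun _ => 1)
    simpa using this
  have hp1 : ∑ x ∈ V', ((Ex x).card : ℝ) / E.card = 1 := by
    rw [← sum_div, hd1, div_self hN.ne']
  have hdlog : ∑ x ∈ V', ((Ex x).card : ℝ) * Real.log (Ex x).card = H 1 := by
    change _ = ∑ e ∈ E, Real.log (g 1 e)
    rw [← hfib]
    refine sum_congr rfl fun x _ => ?_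
    rw [← nsmul_eq_mul, ← sum_const]
    refine sum_congr rfl fun e he => ?_
    rw [← hg1, (mem_filter.1 he).2]
  have G1 := gibbs V' (fun x => ((Ex x).card : ℝ) / E.card) Z (fun x _ => div_nonneg (Nat.cast_nonneg _) hN.le)
    (fun x _ => hZ0 x) hp1 (fun x hx _ => (hZx x hx).1)
  have G2 := gibbs V' (fun x => ((Ex x).card : ℝ) / E.card) (fun _ => 1) (fun x _ => div_nonneg (Nat.cast_nonneg _) hN.le)
    (fun x _ => zero_le_one) hp1 (fun x hx _ => zero_lt_one)
  have hV'pos : (0 : ℝ) < V'.card := by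
    exact_mod_cast card_pos.2 ⟨_, hEV' e0 he0⟩
  have hV'n : (V'.card : ℝ) ≤ n := by
    exact_mod_cast (card_le_card (filter_subset _ _)).trans hn
  have hnpos : (0 : ℝ) < n := lt_of_lt_of_le hV'pos hV'n
  have G2' : E.card * Real.log E.card - H 1 ≤ E.card * Real.log n := by
    have h1 : Real.log (∑ x ∈ V', (1 : ℝ)) ≤ Real.log n := by
      simp only [sum_const, nsmul_eq_mul, mul_one]
      exact Real.log_le_log hV'pos hV'n
    have h2 := mul_le_mul_of_nonneg_left (G2.trans h1) hN.le
    refine le_trans (le_of_eq ?_) h2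
    rw [mul_sum, ← hdlog]
    nth_rewrite 1 [← hd1]
    rw [sum_mul, ← sum_sub_distrib]
    refine sum_congr rfl fun x hx => ?_
    rw [Real.log_one, Real.log_div (hdpos x hx).ne' hN.ne', ← mul_assoc (E.card : ℝ),
      mul_div_cancel₀ _ hN.ne']
    ring
  have hsumu : ∑ x ∈ V', ∑ i, ∑ l ∈ Ex x, Real.log (u i l) =
      H 1 - k * (E.card * Real.log E.card) := by
    rw [sum_comm]
    simp only [hfib]
    have h1 : ∀ i : Fin k, ∑ e ∈ E, Real.log (u i e) =
        H (i.val + 1) - H (i.val + 1 + 1) - E.card * Real.log E.card := by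
      intro i
      rw [sum_congr rfl (hlogu i), sum_sub_distrib, sum_sub_distrib, hHr, sum_const, nsmul_eq_mul]
      simp only [hH]
      ring
    rw [sum_congr rfl fun i _ => h1 i, sum_sub_distrib, sum_const, nsmul_eq_mul, card_univ,
      Fintype.card_fin]
    congr 1
    rw [Fin.sum_univ_eq_sum_range (fun i => H (i + 1) - H (i + 1 + 1)) k,
      sum_range_sub' (fun i => H (i + 1)) k, hHk]
    simp
  have G1' : H 1 - k * (E.card * Real.log E.card) + (k * H 1 - k * (E.card * Real.log 4)) -
      H 1 + E.card * Real.log E.card ≤ E.card * Real.log M := by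
    have h1 := mul_le_mul_of_nonneg_left (G1.trans (Real.log_le_log hZpos hZV')) hN.le
    refine le_trans ?_ h1
    have h2 : ∀ x ∈ V', ∑ i, ∑ l ∈ Ex x, Real.log (u i l) +
        (k * ((Ex x).card * Real.log (Ex x).card) - k * ((Ex x).card * Real.log 4)) -
        (Ex x).card * Real.log (Ex x).card + (Ex x).card * Real.log E.card ≤
        E.card * ((Ex x).card / E.card * (Real.log (Z x) - Real.log ((Ex x).card / E.card))) := by
      intro x hx
      have h3 := (hZx x hx).2
      rw [Real.log_div (hdpos x hx).ne' hN.ne', ← mul_assoc (E.card : ℝ), mul_div_cancel₀ _ hN.ne']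
      linarith
    refine le_trans (le_of_eq ?_) ((sum_le_sum h2).trans (le_of_eq (mul_sum _ _ _).symm))
    rw [sum_add_distrib, sum_sub_distrib, sum_add_distrib, sum_sub_distrib, hsumu, ← mul_sum,
      hdlog, ← mul_sum, ← sum_mul, ← sum_mul, hd1]
  have hk0 : (0 : ℝ) ≤ k := Nat.cast_nonneg k
  have hfin : E.card * Real.log E.card ≤
      E.card * (k * Real.log 4 + Real.log M + k * Real.log n) := by
    have := mul_le_mul_of_nonneg_left G2' hk0
    linarith
  have hfin2 := le_of_mul_le_mul_left hfin hN
  have : Real.log E.card ≤ Real.log (4 ^ k * M * n ^ k) := by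
    rw [Real.log_mul (by positivity) (by positivity), Real.log_mul (by positivity) (by positivity),
      Real.log_pow, Real.log_pow]
    exact hfin2
  have := (Real.log_le_log_iff hN (by positivity)).1 this
  exact_mod_cast this

lemma link_bound {X : Type*} [DecidableEq X] (D : Finset (Finset X))
    (down : ∀ s ∈ D, ∀ t, t ⊆ s → t ∈ D) (m k T : ℕ)
    (hZ : ∀ Z : Finset X, Z.card ≤ m → (D.filter (· ⊆ Z)).card ≤ T)
    (hkm : k + 1 ≤ m) (hT : T < 2 ^ (k + 1) * (m - (k + 1)))
    (f : Finset X) (hf : f.card = k + 1) :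
    (D.filter (fun B => f ⊆ B)).card ≤ T := by
  set V : Finset X := (D.biUnion id).filter (fun v => v ∉ f ∧ insert v f ∈ D) with hV
  have hVc : V.card < m - (k + 1) := by
    by_contra! hcon
    obtain ⟨V', hV'V, hV'c⟩ := exists_subset_card_eq hcon
    have hV' : ∀ v ∈ V', v ∉ f ∧ insert v f ∈ D := fun v hv => (mem_filter.1 (hV'V hv)).2
    have h1 := hZ (f ∪ V') (by
      refine (card_union_le _ _).trans ?_
      omega)
    have h2 : (f.powerset ×ˢ V').card ≤ (D.filter (· ⊆ f ∪ V')).card := by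
      refine card_le_card_of_injOn (fun p => insert p.2 p.1) ?_ ?_
      · rintro ⟨A, v⟩ hp
        simp only [coe_product, Set.mem_prod, mem_coe, mem_powerset] at hp
        simp only [coe_filter, Set.mem_ofPred_eq]
        refine ⟨down _ (hV' v hp.2).2 _ (insert_subset_insert _ hp.1), ?_⟩
        refine insert_subset (mem_union_right _ hp.2) (hp.1.trans subset_union_left)
      · rintro ⟨A, v⟩ hp ⟨B, w⟩ hq heq
        simp only [coe_product, Set.mem_prod, mem_coe, mem_powerset] at hp hq
        simp only at heq
        have hv := (hV' v hp.2).1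
        have hw := (hV' w hq.2).1
        have hvw : v = w := by
          have : v ∈ insert w B := heq ▸ mem_insert_self v A
          rcases mem_insert.1 this with h | h
          · exact h
          · exact absurd (hq.1 h) hv
        subst hvw
        have h3 : (insert v A).erase v = (insert v B).erase v := by rw [heq]
        rw [erase_insert (fun h => hv (hp.1 h)), erase_insert (fun h => hv (hq.1 h))] at h3
        rw [h3]
    rw [card_product, card_powerset, hf, hV'c] at h2
    omega
  refine le_trans (card_le_card ?_) (hZ (f ∪ V) ((card_union_le _ _).trans (by omega)))
  intro B hB
  rw [mem_filter] at hB ⊢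
  refine ⟨hB.1, fun v hv => ?_⟩
  by_cases hvf : v ∈ f
  · exact mem_union_left _ hvf
  · refine mem_union_right _ (mem_filter.2 ⟨mem_biUnion.2 ⟨B, hB.1, hv⟩, hvf, ?_⟩)
    exact down B hB.1 _ (insert_subset hv hB.2)

lemma csum (k : ℕ) : 1 + ∑ i : Fin k, (2 ^ (i.val + 1) - 1) + k + 1 = 2 ^ (k + 1) := by
  rw [Fin.sum_univ_eq_sum_range (fun i => 2 ^ (i + 1) - 1) k]
  induction k with
  | zero => simp
  | succ k ih =>
    rw [sum_range_succ]
    have : 1 ≤ 2 ^ (k + 1) := Nat.one_le_two_pow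
    rw [pow_succ 2 (k + 1)]
    omega

lemma tri (k : ℕ) : 2 * ∑ i : Fin k, (i.val + 1) = k * (k + 1) := by
  rw [Fin.sum_univ_eq_sum_range (fun i => i + 1) k]
  induction k with
  | zero => simp
  | succ k ih =>
    rw [sum_range_succ, mul_add, ih]
    ring

lemma star_bound {X : Type*} [DecidableEq X] (D : Finset (Finset X))
    (down : ∀ s ∈ D, ∀ t, t ⊆ s → t ∈ D) (m k T s : ℕ) (hk : 1 ≤ k)
    (hZ : ∀ Z : Finset X, Z.card ≤ m → (D.filter (· ⊆ Z)).card ≤ T)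
    (hs : 2 * s = k * (k + 1)) (hsm : s ≤ m)
    (hT : T < (1 + ∑ i : Fin k, (2 ^ (i.val + 1) - 1)) * (m - s))
    (f : Fin k → Finset X) (hfc : ∀ i, (f i).card = i.val + 1)
    (hdis : ∀ i i', i ≠ i' → Disjoint (f i) (f i'))
    (Q : Finset X) (hQ : ∀ x ∈ Q, ∀ i, x ∉ f i ∧ insert x (f i) ∈ D) :
    Q.card ≤ m := by
  by_contra! hcon
  obtain ⟨Q', hQ'Q, hQ'c⟩ := exists_subset_card_eq (show m - s ≤ Q.card by omega)
  set U := univ.biUnion f with hU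
  have hUc : U.card ≤ s := by
    have h1 : U.card ≤ ∑ i : Fin k, (i.val + 1) := by
      refine card_biUnion_le.trans (sum_le_sum fun i _ => (hfc i).le)
    have := tri k
    omega
  have hfU : ∀ i, f i ⊆ U := fun i => subset_biUnion_of_mem f (mem_univ i)
  have hQU : ∀ x ∈ Q', x ∉ U := by
    intro x hx hxU
    obtain ⟨i, _, hi⟩ := mem_biUnion.1 hxU
    exact (hQ x (hQ'Q hx) i).1 hi
  set P : Finset (Finset X) := insert ∅ (univ.biUnion fun i => (f i).powerset.erase ∅) with hP
  have hPc : P.card = 1 + ∑ i : Fin k, (2 ^ (i.val + 1) - 1) := by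
    rw [hP, card_insert_of_notMem, card_biUnion, add_comm]
    · congr 1
      refine sum_congr rfl fun i _ => ?_
      rw [card_erase_of_mem (empty_mem_powerset _), card_powerset, hfc]
    · intro i _ i' _ hii
      rw [Function.onFun, Finset.disjoint_left]
      intro A hA hA'
      rw [mem_erase, mem_powerset] at hA hA'
      obtain ⟨y, hy⟩ := nonempty_iff_ne_empty.2 hA.1
      exact (Finset.disjoint_left.1 (hdis i i' hii)) (hA.2 hy) (hA'.2 hy)
    · simp
  have hPU : ∀ A ∈ P, A ⊆ U ∧ ∀ x ∈ Q', insert x A ∈ D := by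
    intro A hA
    rcases mem_insert.1 hA with h | h
    · subst h
      refine ⟨empty_subset _, fun x hx => ?_⟩
      exact down _ (hQ x (hQ'Q hx) ⟨0, hk⟩).2 _ (insert_subset_insert _ (empty_subset _))
    · obtain ⟨i, _, hi⟩ := mem_biUnion.1 h
      rw [mem_erase, mem_powerset] at hi
      exact ⟨hi.2.trans (hfU i), fun x hx =>
        down _ (hQ x (hQ'Q hx) i).2 _ (insert_subset_insert _ hi.2)⟩
  have h1 := hZ (U ∪ Q') ((card_union_le _ _).trans (by omega))
  have h2 : (P ×ˢ Q').card ≤ (D.filter (· ⊆ U ∪ Q')).card := by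
    refine card_le_card_of_injOn (fun p => insert p.2 p.1) ?_ ?_
    · rintro ⟨A, v⟩ hp
      simp only [coe_product, Set.mem_prod, mem_coe] at hp
      simp only [coe_filter, Set.mem_ofPred_eq]
      refine ⟨(hPU A hp.1).2 v hp.2, ?_⟩
      exact insert_subset (mem_union_right _ hp.2) ((hPU A hp.1).1.trans subset_union_left)
    · rintro ⟨A, v⟩ hp ⟨B, w⟩ hq heq
      simp only [coe_product, Set.mem_prod, mem_coe] at hp hq
      simp only at heq
      have hv := hQU v hp.2
      have hA := (hPU A hp.1).1
      have hB := (hPU B hq.1).1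
      have hvw : v = w := by
        have : v ∈ insert w B := heq ▸ mem_insert_self v A
        rcases mem_insert.1 this with h | h
        · exact h
        · exact absurd (hB h) hv
      subst hvw
      have h3 : (insert v A).erase v = (insert v B).erase v := by rw [heq]
      rw [erase_insert (fun h => hv (hA h)), erase_insert (fun h => hv (hB h))] at h3
      rw [h3]
  rw [card_product, hPc, hQ'c] at h2
  omega

lemma face_count {X : Type*} [DecidableEq X] (D : Finset (Finset X)) (Y : Finset X)
    (hDY : ∀ s ∈ D, s ⊆ Y) (n k T : ℕ) (hn : Y.card = n) (hn1 : 1 ≤ n)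
    (hl : ∀ f : Finset X, f.card = k + 1 → (D.filter (fun B => f ⊆ B)).card ≤ T)
    (down : ∀ s ∈ D, ∀ t, t ⊆ s → t ∈ D) :
    D.card ≤ (k + 1) * n ^ k + (D.filter (fun f => f.card = k + 1)).card * T := by
  have hsub : D ⊆ ((range (k + 1)).biUnion fun i => Y.powersetCard i) ∪
      ((D.filter (fun f => f.card = k + 1)).biUnion fun f => D.filter (fun B => f ⊆ B)) := by
    intro B hB
    rw [mem_union]
    by_cases h : B.card < k + 1
    · left
      exact mem_biUnion.2 ⟨B.card, mem_range.2 h, mem_powersetCard.2 ⟨hDY B hB, rfl⟩⟩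
    · right
      obtain ⟨f, hfB, hfc⟩ := exists_subset_card_eq (not_lt.1 h)
      exact mem_biUnion.2 ⟨f, mem_filter.2 ⟨down B hB f hfB, hfc⟩, mem_filter.2 ⟨hB, hfB⟩⟩
  refine (card_le_card hsub).trans ((card_union_le _ _).trans (add_le_add ?_ ?_))
  · refine card_biUnion_le.trans ?_
    calc _ ≤ ∑ _i ∈ range (k + 1), n ^ k := by
          refine sum_le_sum fun i hi => ?_
          rw [card_powersetCard, hn]
          exact (Nat.choose_le_pow n i).trans
            (Nat.pow_le_pow_right hn1 (Nat.lt_succ_iff.1 (mem_range.1 hi)))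
      _ = _ := by simp
  · refine card_biUnion_le.trans ?_
    calc _ ≤ ∑ _f ∈ D.filter (fun f => f.card = k + 1), T :=
          sum_le_sum fun f hf => hl f (mem_filter.1 hf).2
      _ = _ := by simp

lemma numerics (m k T : ℕ) (hk : 1 ≤ k) (hT : T + 2 ^ (4 * k) + (k + 1) * m ≤ 2 ^ (k + 1) * m) :
    2 ^ (3 * k) ≤ 2 * m ∧ k + 1 ≤ 2 ^ k ∧ 2 * k ≤ 2 ^ k := by
  refine ⟨?_, Nat.lt_two_pow_self, ?_⟩
  · have h1 : 2 ^ (4 * k) ≤ 2 ^ (k + 1) * m := by omega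
    have h2 : 2 ^ (4 * k) = 2 ^ k * 2 ^ (3 * k) := by rw [← pow_add]; congr 1; ring
    rw [h2, pow_succ, mul_assoc] at h1
    exact Nat.le_of_mul_le_mul_left h1 (by positivity)
  · obtain ⟨j, rfl⟩ : ∃ j, k = j + 1 := ⟨k - 1, by omega⟩
    have : j < 2 ^ j := Nat.lt_two_pow_self
    rw [pow_succ]; omega

open Classical in
/-- Ordered edges: injective tuples in `V` whose range is a face of `D`. -/
noncomputable def OE {X : Type*} [Fintype X] (D : Finset (Finset X)) (k : ℕ) (V : Finset X) :
    Finset (Fin (k + 1) → X) :=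
  univ.filter (fun e => Function.Injective e ∧ univ.image e ∈ D ∧ ∀ a, e a ∈ V)

open Classical in
lemma mem_OE {X : Type*} [Fintype X] (D : Finset (Finset X)) (k : ℕ) (V : Finset X)
    (e : Fin (k + 1) → X) :
    e ∈ OE D k V ↔ Function.Injective e ∧ univ.image e ∈ D ∧ ∀ a, e a ∈ V := by
  simp [OE]

lemma OE_perm {X : Type*} [Fintype X] (D : Finset (Finset X)) (k : ℕ) (V : Finset X)
    (σ : Equiv.Perm (Fin (k + 1))) (e : Fin (k + 1) → X) (he : e ∈ OE D k V) :
    e ∘ σ ∈ OE D k V := by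
  classical
  rw [mem_OE] at he ⊢
  refine ⟨he.1.comp σ.injective, ?_, fun a => he.2.2 _⟩
  convert he.2.1 using 1
  ext x
  simp only [mem_image, mem_univ, true_and, Function.comp]
  exact ⟨fun ⟨a, ha⟩ => ⟨_, ha⟩, fun ⟨a, ha⟩ => ⟨σ.symm a, by simpa using ha⟩⟩

open Classical in
lemma prune {X : Type*} [Fintype X] (D : Finset (Finset X)) (k K : ℕ) (Y : Finset X) :
    ∃ V ⊆ Y, (∀ v ∈ V, K ≤ ((OE D k V).filter (fun e => e 0 = v)).card) ∧
      (OE D k Y).card ≤ (OE D k V).card + (k + 1) * K * Y.card := by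
  obtain ⟨V, hV, hmax⟩ := exists_max_image Y.powerset
    (fun V => ((OE D k V).card : ℤ) - ((k + 1) * K : ℕ) * (V.card : ℤ)) ⟨Y, by simp⟩
  rw [mem_powerset] at hV
  refine ⟨V, hV, ?_, ?_⟩
  · intro v hv
    have h1 := hmax (V.erase v) (mem_powerset.2 ((erase_subset _ _).trans hV))
    have h2 : (OE D k V).card ≤ (OE D k (V.erase v)).card +
        (k + 1) * ((OE D k V).filter (fun e => e 0 = v)).card := by
      have hsub : OE D k V ⊆ OE D k (V.erase v) ∪
          univ.biUnion (fun a : Fin (k + 1) => (OE D k V).filter (fun e => e a = v)) := by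
        intro e he
        rw [mem_union]
        by_cases h : ∃ a, e a = v
        · obtain ⟨a, ha⟩ := h
          exact Or.inr (mem_biUnion.2 ⟨a, mem_univ _, mem_filter.2 ⟨he, ha⟩⟩)
        · left
          rw [mem_OE] at he ⊢
          push Not at h
          exact ⟨he.1, he.2.1, fun a => mem_erase.2 ⟨h a, he.2.2 a⟩⟩
      refine (card_le_card hsub).trans ((card_union_le _ _).trans (add_le_add le_rfl ?_))
      refine card_biUnion_le.trans ?_
      calc _ ≤ ∑ _a : Fin (k + 1), ((OE D k V).filter (fun e => e 0 = v)).card := by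
            refine sum_le_sum fun a _ => ?_
            refine card_le_card_of_injOn (fun e => e ∘ Equiv.swap 0 a) ?_ ?_
            · intro e he
              rw [mem_coe, mem_filter] at he ⊢
              exact ⟨OE_perm D k V _ e he.1, by simpa using he.2⟩
            · intro e _ e' _ h
              exact (Equiv.swap 0 a).surjective.injective_comp_right h
        _ = _ := by simp
    rw [card_erase_of_mem hv] at h1
    have h3 : 1 ≤ V.card := card_pos.2 ⟨v, hv⟩
    rw [Nat.cast_sub h3] at h1
    have h4 : ((k + 1) * K : ℕ) ≤ (k + 1) * ((OE D k V).filter (fun e => e 0 = v)).card := by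
      have h2' : ((OE D k V).card : ℤ) ≤ (OE D k (V.erase v)).card +
        ((k + 1) * ((OE D k V).filter (fun e => e 0 = v)).card : ℕ) := by exact_mod_cast h2
      have : (((k + 1) * K : ℕ) : ℤ) ≤
        ((k + 1) * ((OE D k V).filter (fun e => e 0 = v)).card : ℕ) := by
        rw [mul_sub] at h1
        push_cast at *
        linarith
      exact_mod_cast this
    exact Nat.le_of_mul_le_mul_left h4 (by omega)
  · have h1 := hmax Y (mem_powerset.2 subset_rfl)
    have h2 : (0 : ℤ) ≤ ((k + 1) * K : ℕ) * (V.card : ℤ) := by positivity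
    have : ((OE D k Y).card : ℤ) ≤ (OE D k V).card + ((k + 1) * K : ℕ) * (Y.card : ℤ) := by
      linarith
    exact_mod_cast this

open Classical in
lemma bad_count {X : Type*} [Fintype X] (D : Finset (Finset X)) (k : ℕ) (V : Finset X)
    (e : Fin (k + 1) → X) :
    ((OE D k V).filter (fun e' => e' 0 = e 0 ∧ Meet e e')).card ≤ k * k * V.card ^ (k - 1) := by
  have hsub : (OE D k V).filter (fun e' => e' 0 = e 0 ∧ Meet e e') ⊆
      (univ : Finset (Fin k × Fin k)).biUnion (fun p =>
        Fintype.piFinset (Fin.cons {e 0} (fun j => if j = p.2 then {e p.1.succ} else V) :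
          Fin (k + 1) → Finset X)) := by
    intro e' he'
    rw [mem_filter, mem_OE] at he'
    obtain ⟨⟨_, _, hV⟩, h0, a, b, hab⟩ := he'
    refine mem_biUnion.2 ⟨(a, b), mem_univ _, ?_⟩
    rw [Fintype.mem_piFinset]
    intro j
    induction j using Fin.cases with
    | zero => simpa using h0
    | succ j =>
      rw [Fin.cons_succ]
      split_ifs with h
      · subst h
        rw [mem_singleton, hab]
      · exact hV _
  refine (card_le_card hsub).trans (card_biUnion_le.trans ?_)
  calc _ ≤ ∑ _p : Fin k × Fin k, V.card ^ (k - 1) := by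
        refine sum_le_sum fun p _ => ?_
        rw [Fintype.card_piFinset, Fin.prod_univ_succ]
        simp only [Fin.cons_zero, Fin.cons_succ, card_singleton, one_mul]
        have : ∀ j : Fin k, (if j = p.2 then {e p.1.succ} else V : Finset X).card =
            if j = p.2 then 1 else V.card := by
          intro j; split_ifs <;> simp
        simp only [this]
        rw [prod_ite, prod_const_one, one_mul, prod_const, filter_ne', card_erase_of_mem (mem_univ _),
          card_univ, Fintype.card_fin]
    _ = _ := by simp

lemma edges_bound {X : Type*} [inst : DecidableEq X] [Fintype X] (D : Finset (Finset X)) (Y : Finset X)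
    (m k n : ℕ) (hk : 1 ≤ k) (hn : Y.card = n)
    (down : ∀ s ∈ D, ∀ t, t ⊆ s → t ∈ D)
    (hstar : ∀ f : Fin k → Finset X, (∀ i, (f i).card = i.val + 1) →
      (∀ i i', i ≠ i' → Disjoint (f i) (f i')) →
      ∀ Q : Finset X, (∀ x ∈ Q, ∀ i, x ∉ f i ∧ insert x (f i) ∈ D) → Q.card ≤ m) :
    (OE D k Y).card ≤ 4 ^ k * m * n ^ k + (k + 1) * (8 * k ^ 3) * n ^ k := by
  obtain rfl : inst = fun a b => Classical.propDecidable (a = b) := Subsingleton.elim _ _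
  classical
  obtain ⟨V, hVY, hdeg, hcard⟩ := prune D k (8 * k ^ 3 * n ^ (k - 1)) Y
  have hVn : V.card ≤ n := hn ▸ card_le_card hVY
  have hent := entropy (OE D k V) V n m hVn (fun e he => ((mem_OE D k V e).1 he).2.2 0)
    (by
      intro e
      refine ⟨OE_perm D k V _ e, fun h => ?_⟩
      have := OE_perm D k V (finRotate (k + 1)).symm _ h
      convert this using 1
      funext a; simp)
    (by
      intro e he
      have h1 := hdeg (e 0) (((mem_OE D k V e).1 he).2.2 0)
      have h2 := bad_count D k V e
      have h3 : V.card ^ (k - 1) ≤ n ^ (k - 1) := Nat.pow_le_pow_left hVn _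
      calc _ ≤ 8 * k * (k * k * n ^ (k - 1)) := by
            refine Nat.mul_le_mul_left _ ?_
            refine le_trans (le_of_eq ?_) (h2.trans (Nat.mul_le_mul_left _ h3))
            congr
        _ = 8 * k ^ 3 * n ^ (k - 1) := by ring
        _ ≤ _ := h1.trans (le_of_eq (by congr)))
    (by
      intro e' he' hdis
      refine hstar (fun i => (Iic i).image (fun a => e' i a.succ))
        ?_ ?_ _ ?_
      · intro i
        rw [card_image_of_injective]
        · exact Fin.card_Iic i
        · intro a b hab
          have := ((mem_OE D k V _).1 (he' i)).1 hab
          exact Fin.succ_injective _ this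
      · intro i i' hii
        rw [Finset.disjoint_left]
        intro y hy hy'
        simp only [mem_image, mem_Iic] at hy hy'
        obtain ⟨a, ha, rfl⟩ := hy
        obtain ⟨b, hb, hab⟩ := hy'
        exact hdis i i' hii a b ha hb hab.symm
      · intro x hx i
        have hx := (@Finset.mem_filter _ _ _ _ _).1 hx
        obtain ⟨e, he, h0, hag⟩ := hx.2 i
        have he2 := (mem_OE D k V e).1 he
        constructor
        · intro hmem
          simp only [mem_image, mem_Iic] at hmem
          obtain ⟨a, ha, hax⟩ := hmem
          rw [← hag a ha, ← h0] at hax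
          exact absurd (he2.1 hax) (Fin.succ_ne_zero a)
        · refine down (univ.image e) (by convert he2.2.1) _ ?_
          intro y hy
          rcases mem_insert.1 hy with h | h
          · exact mem_image.2 ⟨0, mem_univ _, by rw [h0, h]⟩
          · simp only [mem_image, mem_Iic] at h
            obtain ⟨a, ha, hax⟩ := h
            exact mem_image.2 ⟨a.succ, mem_univ _, by rw [hag a ha, hax]⟩)
  refine hcard.trans (add_le_add hent (le_of_eq ?_))
  rw [hn]
  obtain ⟨j, rfl⟩ : ∃ j, k = j + 1 := ⟨k - 1, by omega⟩
  simp only [Nat.add_sub_cancel]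
  ring

lemma faces_le_edges {X : Type*} [DecidableEq X] [Fintype X] (D : Finset (Finset X)) (Y : Finset X)
    (k : ℕ) (hDY : ∀ s ∈ D, s ⊆ Y) :
    (D.filter (fun f => f.card = k + 1)).card ≤ (OE D k Y).card := by
  refine card_le_card_of_surjOn (fun e => univ.image e) ?_
  intro f hf
  rw [mem_coe, mem_filter] at hf
  set φ := (f.equivFinOfCardEq hf.2).symm with hφ
  have him : univ.image (fun a => (φ a : X)) = f := by
    ext x
    simp only [mem_image, mem_univ, true_and]
    constructor
    · rintro ⟨a, rfl⟩
      exact (φ a).2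
    · intro hx
      exact ⟨φ.symm ⟨x, hx⟩, by simp⟩
  refine ⟨fun a => (φ a : X), ?_, him⟩
  rw [mem_coe, mem_OE]
  refine ⟨fun a b h => φ.injective (Subtype.ext h), ?_, fun a => hDY f hf.1 (φ a).2⟩
  convert hf.1 using 1
  refine Eq.trans ?_ him
  congr
  exact Subsingleton.elim _ _

set_option maxHeartbeats 1000000 in
lemma comb {X : Type*} [DecidableEq X] [Fintype X] (D : Finset (Finset X)) (Y : Finset X)
    (m k n T : ℕ) (hk : 1 ≤ k) (hn : Y.card = n) (hmn : m ≤ n)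
    (hDY : ∀ s ∈ D, s ⊆ Y)
    (down : ∀ s ∈ D, ∀ t, t ⊆ s → t ∈ D)
    (hZ : ∀ Z : Finset X, Z.card ≤ m → (D.filter (· ⊆ Z)).card ≤ T)
    (hT : T + 2 ^ (4 * k) + (k + 1) * m ≤ 2 ^ (k + 1) * m) :
    D.card ≤ 2 ^ (k + 2) * m ^ (2 * k + 2) * n ^ k := by
  obtain ⟨n1, n2, n3⟩ := numerics m k T hk hT
  have hcs := csum k
  set c := 1 + ∑ i : Fin k, (2 ^ (i.val + 1) - 1) with hc
  have htri := tri k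
  set s := ∑ i : Fin k, (i.val + 1) with hs
  set q := 2 ^ k with hq
  have hq2 : 2 ≤ q := by
    calc 2 = 2 ^ 1 := rfl
      _ ≤ 2 ^ k := Nat.pow_le_pow_right (by norm_num) hk
  have e3 : 2 ^ (3 * k) = q ^ 3 := by rw [hq, ← pow_mul, mul_comm]
  have e4 : 2 ^ (4 * k) = q ^ 4 := by rw [hq, ← pow_mul, mul_comm]
  have e1 : 2 ^ (k + 1) = 2 * q := by rw [pow_succ, mul_comm]
  have e5 : 4 ^ k = q ^ 2 := by rw [hq, ← pow_mul, mul_comm, pow_mul]; norm_num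
  clear_value q
  rw [e3] at n1
  rw [e4, e1] at hT
  rw [e1] at hcs
  have hqm : q ^ 2 ≤ m := by nlinarith
  have h2qm : 2 * q ≤ m := by nlinarith
  have hkm : k + 1 ≤ m := by omega
  have hTm : T ≤ m * m := by nlinarith
  have hs4 : 4 * s ≤ q * q := by nlinarith
  have hsm : s ≤ m := by nlinarith
  have hcq : c ≤ 2 * q := by omega
  have hcm : c * m = 2 * q * m - (k + 1) * m := by
    rw [← Nat.sub_mul]; congr 1; omega
  have hq4 : q ^ 2 * 4 ≤ q ^ 4 := by nlinarith [Nat.pow_le_pow_left hq2 2, sq_nonneg q]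
  have hqpos : 0 < q ^ 2 := by positivity
  have hqpos3 : 0 < q ^ 3 := by positivity
  have hq34 : q ^ 3 ≤ q ^ 4 := Nat.pow_le_pow_right (by omega) (by norm_num)
  have hlink := face_count D Y hDY n k T hn (by omega) (fun f hf =>
    link_bound D down m k T hZ hkm (by
      rw [e1]
      have h1 : 2 * q * (m - (k + 1)) = 2 * q * m - 2 * q * (k + 1) := Nat.mul_sub _ _ _
      have h2 : 2 * q * (k + 1) ≤ 2 * q * q := Nat.mul_le_mul_left _ n2
      have h3 : 2 * q * q < q ^ 4 := by
        have h5 : 2 * q * q = 2 * q ^ 2 := by ring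
        omega
      omega) f hf) down
  have hedge := edges_bound D Y m k n hk hn down (fun f hfc hdis Q hQ =>
    star_bound D down m k T s hk hZ htri hsm (by
      rw [← hc, Nat.mul_sub, hcm]
      have h2 : c * s ≤ 2 * q * s := Nat.mul_le_mul_right _ hcq
      have h3 : 2 * q * s < q ^ 4 := by
        have h5 : q * (4 * s) ≤ q * (q * q) := Nat.mul_le_mul_left _ hs4
        have h6 : q * (q * q) = q ^ 3 := by ring
        have h7 : q * (4 * s) = 2 * (2 * q * s) := by ring
        omega
      omega) f hfc hdis Q hQ)
  have hfe := faces_le_edges D Y k hDY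
  have h8 : (k + 1) * (8 * k ^ 3) ≤ m * m := by
    have h1 : (2 * k) ^ 3 ≤ q ^ 3 := Nat.pow_le_pow_left n3 3
    have h2 : (k + 1) * (8 * k ^ 3) ≤ q * q ^ 3 := by
      calc (k + 1) * (8 * k ^ 3) = (k + 1) * (2 * k) ^ 3 := by ring
        _ ≤ _ := Nat.mul_le_mul n2 h1
    have h3 := Nat.mul_le_mul hqm hqm
    have h4 : q * q ^ 3 = q ^ 2 * q ^ 2 := by ring
    omega
  rw [e5] at hedge
  have hE : (OE D k Y).card ≤ 2 * (m * m) * n ^ k := by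
    refine hedge.trans ?_
    rw [← add_mul]
    refine Nat.mul_le_mul_right _ ?_
    have h3 := Nat.mul_le_mul_right m hqm
    omega
  have hm1 : 1 ≤ m := by omega
  calc D.card ≤ m * n ^ k + 2 * (m * m) * n ^ k * (m * m) := by
        refine hlink.trans (add_le_add (Nat.mul_le_mul_right _ hkm) ?_)
        exact Nat.mul_le_mul (hfe.trans hE) hTm
    _ = (m + 2 * m ^ 4) * n ^ k := by ring
    _ ≤ _ := by
        refine Nat.mul_le_mul_right _ ?_
        have h1 : m ^ 4 ≤ m ^ (2 * k + 2) := Nat.pow_le_pow_right hm1 (by omega)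
        have h2 : m ^ 1 ≤ m ^ (2 * k + 2) := Nat.pow_le_pow_right hm1 (by omega)
        have h3 : 2 ^ 3 ≤ 2 ^ (k + 2) := Nat.pow_le_pow_right (by norm_num) (by omega)
        nlinarith

end ShatterAux

/-- **Theorem (lower bound of Theorem 1, integer case).** For integers `m, k ≥ 1` and any
finite set system `S`, if `f_S(m) ≤ (2^(k+1)−k−1)·m − 2^(4k)`, then for all `n ≥ m`,
`f_S(n) ≤ 2^(k+2) · m^(2k+2) · n^k`.  (Hence `t_k(m) > (2^(k+1)−k−1)m − 2^(4k)`.) -/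
theorem integer_shatter_lower_bound {X : Type*} [DecidableEq X] [Fintype X]
    (m k : ℕ) (hm : 1 ≤ m) (hk : 1 ≤ k)
    (S : Finset (Finset X))
    (hS : (shatter S m : ℤ) ≤ (2 ^ (k + 1) - k - 1) * m - 2 ^ (4 * k)) :
    ∀ n : ℕ, m ≤ n →
      (shatter S n : ℤ) ≤ 2 ^ (k + 2) * (m : ℤ) ^ (2 * k + 2) * (n : ℤ) ^ k := by
  intro n hmn
  have hT : shatter S m + 2 ^ (4 * k) + (k + 1) * m ≤ 2 ^ (k + 1) * m := by
    zify
    linarith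
  suffices h : shatter S n ≤ 2 ^ (k + 2) * m ^ (2 * k + 2) * n ^ k by exact_mod_cast h
  refine Finset.sup_le fun Y hY => ?_
  have hYn : Y.card = n := (Finset.mem_powersetCard.1 hY).2
  obtain ⟨D, hDc, htr, down⟩ := ShatterAux.exists_downset (S.image (· ∩ Y))
  rw [← hDc]
  refine ShatterAux.comb D Y m k n (shatter S m) hk hYn hmn ?_ down ?_ hT
  · intro s hs v hv
    by_contra hvY
    have h1 : ({∅, {v}} : Finset (Finset X)) ⊆ D.filter (· ⊆ {v}) := by
      intro t ht
      have htv : t ⊆ {v} := by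
        rcases Finset.mem_insert.1 ht with h | h
        · rw [h]; exact Finset.empty_subset _
        · rw [Finset.mem_singleton.1 h]
      exact Finset.mem_filter.2
        ⟨down s hs t (htv.trans (Finset.singleton_subset_iff.2 hv)), htv⟩
    have h2 := (Finset.card_le_card h1).trans (htr {v})
    have h3 : (S.image (· ∩ Y)).image (· ∩ {v}) ⊆ {∅} := by
      intro t ht
      simp only [Finset.mem_image] at ht
      obtain ⟨_, ⟨e, _, rfl⟩, rfl⟩ := ht
      rw [Finset.mem_singleton]
      ext y
      simp only [Finset.mem_inter, Finset.mem_singleton, Finset.notMem_empty, iff_false]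
      rintro ⟨⟨_, hy⟩, rfl⟩
      exact hvY hy
    have h4 := h2.trans (Finset.card_le_card h3)
    rw [Finset.card_pair (Finset.singleton_ne_empty v).symm, Finset.card_singleton] at h4
    omega
  · intro Z hZ
    refine (htr Z).trans ?_
    obtain ⟨Z', h1, h2, h3⟩ := Finset.exists_subsuperset_card_eq
      (Finset.inter_subset_left (s₁ := Y) (s₂ := Z))
      ((Finset.card_le_card Finset.inter_subset_right).trans hZ) (hYn ▸ hmn)
    have h4 : (S.image (· ∩ Y)).image (· ∩ Z) = (S.image (· ∩ Z')).image (· ∩ (Y ∩ Z)) := by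
      rw [Finset.image_image, Finset.image_image]
      refine Finset.image_congr fun e _ => ?_
      simp only [Function.comp]
      rw [Finset.inter_assoc, Finset.inter_assoc, Finset.inter_eq_right.2 h1]
    rw [h4]
    refine Finset.card_image_le.trans ?_
    exact Finset.le_sup (f := fun Y => (S.image (· ∩ Y)).card)
      (Finset.mem_powersetCard.2 ⟨Finset.subset_univ _, h3⟩)
end

section
/- For any integers m, k ≥ 1 and any real constant C > 0, there exist arbitrarily large integers n and a set system S on an n-element ground set such that f_S(m) ≤ (2^{k+1}−k−1)·m + 2^{k+1}−k−1 and f_S(n) > C·n^k. (In particular, t_k(m) ≤ (2^{k+1}−k−1)m + 2^{k+1}−k−2, where t_k(m) is the largest integer such that every set system S with f_S(m) ≤ t_k(m) satisfies f_S(n) = O(n^k).) -/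
/-- Subsets of size at least two. -/
def bigSub {α : Type*} [DecidableEq α] (T : Finset α) : Finset (Finset α) :=
  T.powerset.filter (fun A => 2 ≤ A.card)

lemma mem_bigSub {α : Type*} [DecidableEq α] (T A : Finset α) :
    A ∈ bigSub T ↔ A ⊆ T ∧ 2 ≤ A.card := by
  simp [bigSub]

lemma card_bigSub {α : Type*} [DecidableEq α] (T : Finset α) :
    (bigSub T).card + T.card + 1 = 2 ^ T.card := by
  have h1 := Finset.card_filter_add_card_filter_not (s := T.powerset) (fun A => 2 ≤ A.card)
  rw [Finset.card_powerset] at h1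
  have h2 : T.powerset.filter (fun A => ¬ 2 ≤ A.card)
      = T.powersetCard 1 ∪ T.powersetCard 0 := by
    ext A
    simp only [Finset.mem_filter, Finset.mem_powerset, Finset.mem_union, Finset.mem_powersetCard]
    constructor
    · rintro ⟨a, b⟩
      have : A.card = 1 ∨ A.card = 0 := by omega
      tauto
    · rintro (⟨a, b⟩ | ⟨a, b⟩)
      · exact ⟨a, by omega⟩
      · exact ⟨a, by omega⟩
  rw [h2, Finset.card_union_of_disjoint, Finset.card_powersetCard, Finset.card_powersetCard] at h1
  · simp at h1
    unfold bigSub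
    omega
  · rw [Finset.disjoint_left]
    intro A hA hB
    rw [Finset.mem_powersetCard] at hA hB
    omega

lemma card_col {α : Type*} [DecidableEq α] [Fintype α] (q : ℕ) [NeZero q] (F : Finset α) :
    (Finset.univ.filter (fun c : α → Fin q => ∀ A ∈ F, c A = 0)).card * q ^ F.card
      = q ^ (Fintype.card α) := by
  have h : Finset.univ.filter (fun c : α → Fin q => ∀ A ∈ F, c A = 0)
      = Fintype.piFinset (fun A => if A ∈ F then ({0} : Finset (Fin q)) else Finset.univ) := by
    ext c
    simp only [Finset.mem_filter, Finset.mem_univ, true_and, Fintype.mem_piFinset]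
    refine forall_congr' fun A => ?_
    by_cases hA : A ∈ F <;> simp [hA]
  rw [h, Fintype.card_piFinset]
  have h2 : ∀ A, (if A ∈ F then ({0} : Finset (Fin q)) else Finset.univ).card
      = if A ∈ F then 1 else q := by
    intro A
    by_cases hA : A ∈ F <;> simp [hA]
  simp only [h2]
  rw [Finset.prod_ite, Finset.prod_const_one, one_mul, Finset.prod_const, ← pow_add]
  congr 1
  have h3 := Finset.card_filter_add_card_filter_not (s := (Finset.univ : Finset α)) (fun A => A ∈ F)
  rw [Finset.filter_mem_eq_inter, Finset.univ_inter, Finset.card_univ] at h3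
  omega

/-- The retained `r`-sets. -/
def kept {n q : ℕ} [NeZero q] (r : ℕ) (c : Finset (Fin n) → Fin q) : Finset (Finset (Fin n)) :=
  (Finset.univ.powersetCard r).filter (fun T => ∀ A ∈ bigSub T, c A = 0)

lemma shatter_kept {n q : ℕ} [NeZero q] (r m N : ℕ) (c : Finset (Fin n) → Fin q)
    (h : ∀ Y : Finset (Fin n), Y.card = m → ∀ F ⊆ bigSub Y, F.card = N + 1 →
      ¬ ∀ A ∈ F, c A = 0) :
    shatter (kept r c) m ≤ N + m + 1 := by
  unfold shatter
  refine Finset.sup_le fun Y hY => ?_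
  have hYm : Y.card = m := (Finset.mem_powersetCard.1 hY).2
  have hsub : (kept r c).image (· ∩ Y) ⊆
      (bigSub Y).filter (fun A => c A = 0) ∪ (Y.powersetCard 1 ∪ Y.powersetCard 0) := by
    intro B hB
    obtain ⟨T, hT, rfl⟩ := Finset.mem_image.1 hB
    have hT2 := (Finset.mem_filter.1 hT).2
    simp only [Finset.mem_union, Finset.mem_filter, mem_bigSub, Finset.mem_powersetCard]
    by_cases h2 : 2 ≤ (T ∩ Y).card
    · left
      exact ⟨⟨Finset.inter_subset_right, h2⟩,
        hT2 _ ((mem_bigSub _ _).2 ⟨Finset.inter_subset_left, h2⟩)⟩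
    · right
      have : (T ∩ Y).card = 1 ∨ (T ∩ Y).card = 0 := by omega
      have h3 : T ∩ Y ⊆ Y := Finset.inter_subset_right
      tauto
  have hN : ((bigSub Y).filter (fun A => c A = 0)).card ≤ N := by
    by_contra hlt
    obtain ⟨F, hF, hFc⟩ := Finset.exists_subset_card_eq
      (s := (bigSub Y).filter (fun A => c A = 0)) (n := N + 1) (by omega)
    exact h Y hYm F (hF.trans (Finset.filter_subset _ _)) hFc
      (fun A hA => (Finset.mem_filter.1 (hF hA)).2)
  refine (Finset.card_le_card hsub).trans ?_
  refine (Finset.card_union_le _ _).trans ?_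
  have h1 := Finset.card_union_le (Y.powersetCard 1) (Y.powersetCard 0)
  rw [Finset.card_powersetCard, Finset.card_powersetCard, hYm, Nat.choose_one_right,
    Nat.choose_zero_right] at h1
  omega

/-- The potentially bad families. -/
def badFam (n m N : ℕ) : Finset (Finset (Finset (Fin n))) :=
  (Finset.univ.powersetCard m).biUnion (fun Y => (bigSub Y).powersetCard N)

lemma card_badFam (n m N : ℕ) : (badFam n m N).card ≤ n ^ m * 2 ^ (2 ^ m) := by
  unfold badFam
  refine (Finset.card_biUnion_le_card_mul _ _ (2 ^ (2 ^ m)) ?_).trans ?_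
  · intro Y hY
    have hYm : Y.card = m := (Finset.mem_powersetCard.1 hY).2
    have h1 : (bigSub Y).powersetCard N ⊆ (Y.powerset).powerset := by
      intro F hF
      rw [Finset.mem_powerset]
      exact (Finset.mem_powersetCard.1 hF).1.trans (Finset.filter_subset _ _)
    have := Finset.card_le_card h1
    rwa [Finset.card_powerset, Finset.card_powerset, hYm] at this
  · refine Nat.mul_le_mul_right _ ?_
    rw [Finset.card_powersetCard, Finset.card_univ, Fintype.card_fin]
    exact Nat.choose_le_pow n m

lemma avg {α β : Type*} [DecidableEq α] [Fintype α] (q d : ℕ) [NeZero q]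
    (P : Finset β) (g : β → Finset α) (hg : ∀ b ∈ P, (g b).card = d) :
    (∑ c : α → Fin q, (P.filter (fun b => ∀ A ∈ g b, c A = 0)).card) * q ^ d
      = P.card * q ^ (Fintype.card α) := by
  have h : ∑ c : α → Fin q, (P.filter (fun b => ∀ A ∈ g b, c A = 0)).card
      = ∑ b ∈ P, (Finset.univ.filter (fun c : α → Fin q => ∀ A ∈ g b, c A = 0)).card := by
    simp only [Finset.card_filter]
    exact Finset.sum_comm
  rw [h, Finset.sum_mul, Finset.card_eq_sum_ones, Finset.sum_mul]
  refine Finset.sum_congr rfl fun b hb => ?_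
  rw [← hg b hb, card_col, one_mul]

/-- The averaging argument. -/
lemma exists_good (n m k D q : ℕ) [NeZero q] (hD : D + k + 2 = 2 ^ (k + 1)) (B : ℝ) (hB0 : 0 ≤ B)
    (hB : B * (q : ℝ) ^ (D * (m + 1) + 1) * (q : ℝ) ^ D
        + (n : ℝ) ^ (k + 1) * ((n : ℝ) ^ m * 2 ^ (2 ^ m)) * (q : ℝ) ^ D
      < (n.choose (k + 1) : ℝ) * (q : ℝ) ^ (D * (m + 1) + 1)) :
    ∃ S : Finset (Finset (Fin n)), shatter S m ≤ D * (m + 1) + m + 1 ∧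
      B < (shatter S n : ℝ) := by
  by_contra hcon
  push Not at hcon
  set M := D * (m + 1) + 1 with hM
  have key : ∀ c : Finset (Fin n) → Fin q, ((kept (k + 1) c).card : ℝ) ≤
      B + (n : ℝ) ^ (k + 1) *
        (((badFam n m M).filter (fun F => ∀ A ∈ id F, c A = 0)).card : ℝ) := by
    intro c
    have hS : (kept (k + 1) c).card ≤ shatter (kept (k + 1) c) n := by
      unfold shatter
      have hu : (Finset.univ : Finset (Fin n)) ∈ Finset.univ.powersetCard n := by
        simp [Finset.mem_powersetCard]
      refine le_trans ?_ (Finset.le_sup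
        (f := fun Y => ((kept (k + 1) c).image (· ∩ Y)).card) hu)
      simp
    have hS2 : (kept (k + 1) c).card ≤ n ^ (k + 1) := by
      refine (Finset.card_filter_le _ _).trans ?_
      rw [Finset.card_powersetCard, Finset.card_univ, Fintype.card_fin]
      exact Nat.choose_le_pow n (k + 1)
    by_cases hb : ((badFam n m M).filter (fun F => ∀ A ∈ id F, c A = 0)) = ∅
    · rw [hb]
      have hgood := shatter_kept (k + 1) m (D * (m + 1)) c (by
        intro Y hY F hF hFc hall
        have : F ∈ (badFam n m M).filter (fun F => ∀ A ∈ id F, c A = 0) := by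
          refine Finset.mem_filter.2 ⟨Finset.mem_biUnion.2 ⟨Y, ?_, ?_⟩, hall⟩
          · exact Finset.mem_powersetCard.2 ⟨Finset.subset_univ _, hY⟩
          · exact Finset.mem_powersetCard.2 ⟨hF, hFc⟩
        rw [hb] at this
        simp at this)
      have h1 := hcon _ hgood
      have h2 : ((kept (k + 1) c).card : ℝ) ≤ (shatter (kept (k + 1) c) n : ℝ) := by
        exact_mod_cast hS
      simp only [Finset.card_empty, Nat.cast_zero, mul_zero, add_zero]
      linarith
    · have hpos : 1 ≤ ((badFam n m M).filter (fun F => ∀ A ∈ id F, c A = 0)).card :=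
        Finset.card_pos.2 (Finset.nonempty_iff_ne_empty.2 hb)
      have hpos' : (1 : ℝ) ≤ (((badFam n m M).filter
          (fun F => ∀ A ∈ id F, c A = 0)).card : ℝ) := by exact_mod_cast hpos
      have h2 : ((kept (k + 1) c).card : ℝ) ≤ (n : ℝ) ^ (k + 1) := by exact_mod_cast hS2
      have h3 : (0 : ℝ) ≤ (n : ℝ) ^ (k + 1) := by positivity
      have := le_mul_of_one_le_right h3 hpos'
      linarith
  have hsum := Finset.sum_le_sum (fun c (_ : c ∈ Finset.univ) => key c)
  have e1 := avg (α := Finset (Fin n)) q D (Finset.univ.powersetCard (k + 1)) bigSub (by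
    intro T hT
    have h1 := (Finset.mem_powersetCard.1 hT).2
    have h2 := card_bigSub T
    rw [h1] at h2
    omega)
  have e2 := avg (α := Finset (Fin n)) q M (badFam n m M) id (by
    intro F hF
    obtain ⟨Y, -, hY⟩ := Finset.mem_biUnion.1 hF
    exact (Finset.mem_powersetCard.1 hY).2)
  have e3 := card_badFam n m M
  rw [Finset.sum_add_distrib, Finset.sum_const, ← Finset.mul_sum, Finset.card_univ,
    Fintype.card_fun, Fintype.card_fin, nsmul_eq_mul] at hsum
  rw [Finset.card_powersetCard, Finset.card_univ, Fintype.card_fin] at e1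
  set Q := q ^ Fintype.card (Finset (Fin n)) with hQ
  have hq : 0 < q := Nat.pos_of_ne_zero (NeZero.ne q)
  have hQ0 : (0 : ℝ) < (Q : ℝ) := by
    have : 0 < Q := by positivity
    exact_mod_cast this
  have hq0 : (0 : ℝ) < (q : ℝ) := by exact_mod_cast hq
  have e1' : (∑ c : Finset (Fin n) → Fin q, ((kept (k + 1) c).card : ℝ)) * (q : ℝ) ^ D
      = (n.choose (k + 1) : ℝ) * Q := by
    exact_mod_cast e1
  have e2' : (∑ c : Finset (Fin n) → Fin q,
      (((badFam n m M).filter (fun F => ∀ A ∈ id F, c A = 0)).card : ℝ)) * (q : ℝ) ^ M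
      ≤ ((n : ℝ) ^ m * 2 ^ (2 ^ m)) * Q := by
    have := e2.le.trans (Nat.mul_le_mul_right Q e3)
    exact_mod_cast this
  generalize (∑ c : Finset (Fin n) → Fin q, ((kept (k + 1) c).card : ℝ)) = S1 at hsum e1'
  generalize (∑ c : Finset (Fin n) → Fin q,
      (((badFam n m M).filter (fun F => ∀ A ∈ id F, c A = 0)).card : ℝ)) = S2 at hsum e2'
  have hqD : (0 : ℝ) < (q : ℝ) ^ D := by positivity
  have hqM : (0 : ℝ) < (q : ℝ) ^ M := by positivity
  have f1 := mul_le_mul_of_nonneg_right hsum (mul_pos hqD hqM).le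
  have f2 := mul_le_mul_of_nonneg_left e2'
    (show (0 : ℝ) ≤ (n : ℝ) ^ (k + 1) * (q : ℝ) ^ D by positivity)
  have f3 := mul_lt_mul_of_pos_right hB hQ0
  have f4 : S1 * ((q : ℝ) ^ D * (q : ℝ) ^ M) = (n.choose (k + 1) : ℝ) * Q * (q : ℝ) ^ M := by
    rw [← e1']; ring
  rw [f4] at f1
  nlinarith [f1, f2, f3]

lemma choose_lower (n k : ℕ) (h : 2 * k ≤ n) :
    n ^ (k + 1) ≤ 2 ^ (k + 1) * (k + 1).factorial * n.choose (k + 1) := by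
  have h1 := Nat.pow_sub_le_descFactorial n (k + 1)
  rw [Nat.descFactorial_eq_factorial_mul_choose] at h1
  have h2 : n ≤ 2 * (n + 1 - (k + 1)) := by omega
  calc n ^ (k + 1) ≤ (2 * (n + 1 - (k + 1))) ^ (k + 1) := Nat.pow_le_pow_left h2 _
    _ = 2 ^ (k + 1) * (n + 1 - (k + 1)) ^ (k + 1) := by rw [mul_pow]
    _ ≤ 2 ^ (k + 1) * ((k + 1).factorial * n.choose (k + 1)) := Nat.mul_le_mul_left _ h1
    _ = _ := by ring

/-- **Theorem (upper bound of Theorem 1).** For any integers `m, k ≥ 1` and any real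
`C > 0`, there exist arbitrarily large integers `n` and a set system `S` on an
`n`-element ground set such that `f_S(m) ≤ (2^(k+1)−k−1)·m + 2^(k+1)−k−1` and
`f_S(n) > C·n^k`.  (Hence `t_k(m) ≤ (2^(k+1)−k−1)m + 2^(k+1)−k−2`.) -/
theorem integer_shatter_upper_bound (m k : ℕ) (hm : 1 ≤ m) (hk : 1 ≤ k)
    (C : ℝ) (hC : 0 < C) (n₀ : ℕ) :
    ∃ n : ℕ, n₀ ≤ n ∧ ∃ S : Finset (Finset (Fin n)),
      (shatter S m : ℤ) ≤ (2 ^ (k + 1) - k - 1) * m + 2 ^ (k + 1) - k - 1 ∧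
      C * (n : ℝ) ^ k < (shatter S n : ℝ) := by
  have hpow : k + 2 ≤ 2 ^ (k + 1) := Nat.lt_two_pow_self (n := k + 1)
  obtain ⟨D, hD⟩ : ∃ D, D + k + 2 = 2 ^ (k + 1) := ⟨2 ^ (k + 1) - (k + 2), by omega⟩
  have hD1 : 1 ≤ D := by
    have h1 : k + 1 ≤ 2 ^ k := Nat.lt_two_pow_self
    have h2 : 2 ^ (k + 1) = 2 * 2 ^ k := by ring
    omega
  set L : ℕ := 2 ^ (k + 1) * (k + 1).factorial with hL
  have hL0 : 0 < L := by positivity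
  obtain ⟨K, hK⟩ := exists_nat_gt ((C + 1) * (L : ℝ))
  have hLr : (0 : ℝ) < (L : ℝ) := by exact_mod_cast hL0
  have hKr : (0 : ℝ) < (K : ℝ) := lt_trans (by positivity) hK
  have hK0 : 0 < K := by exact_mod_cast hKr
  set q : ℕ := K ^ (m + 1) * 2 ^ (2 ^ m) + n₀ + 2 * k with hq
  have hq0 : 0 < q := by positivity
  haveI : NeZero q := ⟨hq0.ne'⟩
  have hqr : (0 : ℝ) < (q : ℝ) := by exact_mod_cast hq0
  set n : ℕ := K * q ^ D with hn
  have hqn : q ≤ n := by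
    calc q ≤ q ^ D := Nat.le_self_pow (by omega) q
      _ ≤ K * q ^ D := Nat.le_mul_of_pos_left _ hK0
  have hnr : (0 : ℝ) < (n : ℝ) := by exact_mod_cast lt_of_lt_of_le hq0 hqn
  have hneq : (n : ℝ) = K * (q : ℝ) ^ D := by rw [hn]; push_cast; ring
  have hch : (n : ℝ) ^ (k + 1) ≤ (L : ℝ) * (n.choose (k + 1) : ℝ) := by
    exact_mod_cast choose_lower n k (by omega)
  have hqW : (K : ℝ) ^ (m + 1) * 2 ^ (2 ^ m) ≤ (q : ℝ) := by
    have : K ^ (m + 1) * 2 ^ (2 ^ m) ≤ q := by omega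
    exact_mod_cast this
  obtain ⟨S, hS1, hS2⟩ := exists_good n m k D q hD (C * (n : ℝ) ^ k) (by positivity) (by
    have g1 : (n : ℝ) ^ (k + 1) * ((n : ℝ) ^ m * 2 ^ (2 ^ m)) * (q : ℝ) ^ D
        ≤ (n : ℝ) ^ k * (q : ℝ) ^ (D * (m + 1) + 1) * (q : ℝ) ^ D := by
      have g2 : (n : ℝ) ^ (k + 1) * ((n : ℝ) ^ m * 2 ^ (2 ^ m))
          = (n : ℝ) ^ k * ((q : ℝ) ^ (D * (m + 1)) * ((K : ℝ) ^ (m + 1) * 2 ^ (2 ^ m))) := by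
        have : (n : ℝ) ^ (m + 1) = (K : ℝ) ^ (m + 1) * (q : ℝ) ^ (D * (m + 1)) := by
          rw [hneq, mul_pow, ← pow_mul]
        calc (n : ℝ) ^ (k + 1) * ((n : ℝ) ^ m * 2 ^ (2 ^ m))
            = (n : ℝ) ^ k * ((n : ℝ) ^ (m + 1) * 2 ^ (2 ^ m)) := by ring
          _ = _ := by rw [this]; ring
      rw [g2, pow_succ (q : ℝ) (D * (m + 1))]
      gcongr
    have g3 : (C + 1) * (n : ℝ) ^ k * (q : ℝ) ^ D < (n.choose (k + 1) : ℝ) := by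
      have g4 : (C + 1) * (L : ℝ) * ((n : ℝ) ^ k * (q : ℝ) ^ D)
          < K * ((n : ℝ) ^ k * (q : ℝ) ^ D) :=
        mul_lt_mul_of_pos_right hK (by positivity)
      have g5 : (n : ℝ) ^ (k + 1) = K * ((n : ℝ) ^ k * (q : ℝ) ^ D) := by
        calc (n : ℝ) ^ (k + 1) = (n : ℝ) ^ k * (n : ℝ) := pow_succ _ _
          _ = (n : ℝ) ^ k * (K * (q : ℝ) ^ D) := by rw [← hneq]
          _ = _ := by ring
      refine lt_of_mul_lt_mul_left (a := (L : ℝ)) ?_ hLr.le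
      calc (L : ℝ) * ((C + 1) * (n : ℝ) ^ k * (q : ℝ) ^ D)
          = (C + 1) * (L : ℝ) * ((n : ℝ) ^ k * (q : ℝ) ^ D) := by ring
        _ < (n : ℝ) ^ (k + 1) := by rw [g5]; exact g4
        _ ≤ _ := hch
    have g6 := mul_lt_mul_of_pos_right g3
      (show (0 : ℝ) < (q : ℝ) ^ (D * (m + 1) + 1) by positivity)
    refine lt_of_le_of_lt ?_ g6
    refine (add_le_add_right g1 _).trans (le_of_eq ?_)
    ring)
  refine ⟨n, by omega, S, ?_, hS2⟩
  have hDz : (D : ℤ) + k + 2 = 2 ^ (k + 1) := by exact_mod_cast hD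
  have hS1z : (shatter S m : ℤ) ≤ D * (m + 1) + m + 1 := by exact_mod_cast hS1
  rw [← hDz]
  refine hS1z.trans (le_of_eq ?_)
  ring
end

section
/- For every choice of integers d, Q ≥ 1 and r ≥ 0, there exist integers i, j with 1 ≤ i ≤ j ≤ Q such that mindens(T_r) = dens_{T_r}(σ_i ∪ σ_{i+1} ∪ … ∪ σ_j). -/
/-- The block `σ_i = {id+1, id+2, …, (i+1)d}` of vertices. -/
def sigmaB (d i : ℕ) : Finset ℕ := Finset.Icc (i * d + 1) ((i + 1) * d)

/-- The `d`-tree `T_0` on vertex set `{1, …, d(Q+1)}`: its simplices are the nonempty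
subsets `σ` with `max σ − min σ ≤ d` (equivalently, `a ≤ b + d` for all `a, b ∈ σ`). -/
def T0 (d Q : ℕ) : Finset (Finset ℕ) :=
  (Finset.Icc 1 (d * (Q + 1))).powerset.filter
    (fun σ => σ.Nonempty ∧ ∀ a ∈ σ, ∀ b ∈ σ, a ≤ b + d)

/-- The `k`-th attached root vertex (for `k = 0, 1, …`): a fresh vertex label. -/
def rootVtx (d Q k : ℕ) : ℕ := d * (Q + 1) + k + 1

/-- The index of the block to which the `k`-th root vertex is attached in `T_r`
(`k = 0, …, r−1`).  Writing `r = aQ + b` with `b = r % Q`, the first `b` vertices are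
attached to `σ_{⌈Q/b⌉}, σ_{⌈2Q/b⌉}, …, σ_{⌈bQ/b⌉} = σ_Q` (coming from the base case
`T_b`), and the remaining `aQ` vertices are attached cyclically to `σ_1, …, σ_Q`
(`a` full rounds), corresponding to the recursion `T_r = T_{r−Q} + (σ_1, …, σ_Q)`. -/
def target (Q r k : ℕ) : ℕ :=
  if k < r % Q then ((k + 1) * Q + (r % Q) - 1) / (r % Q)
  else (k - r % Q) % Q + 1

/-- The rooted `d`-tree `T_r`: the complex `T_0` together with, for each `k < r`, the
root vertex `rootVtx d Q k` attached to the `(d−1)`-simplex `σ_{target Q r k}`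
(attaching adds all sets `τ ∪ {v}` for `τ ⊆ σ`). -/
def Tr (d Q r : ℕ) : Finset (Finset ℕ) :=
  T0 d Q ∪ (Finset.range r).biUnion
    (fun k => (sigmaB d (target Q r k)).powerset.image (insert (rootVtx d Q k)))

/-- The set of vertex roots of `T_r`. -/
def rootSet (d Q r : ℕ) : Finset ℕ := (Finset.range r).image (rootVtx d Q)

/-- `e_C(S)`: the number of nonempty simplices of `C` with at least one vertex in `S`. -/
def eCount (C : Finset (Finset ℕ)) (S : Finset ℕ) : ℕ :=
  (C.filter (fun σ => σ.Nonempty ∧ (σ ∩ S).Nonempty)).card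

/-- The density `dens_C(S) = e_C(S)/|S|`. -/
noncomputable def dens (C : Finset (Finset ℕ)) (S : Finset ℕ) : ℝ :=
  (eCount C S : ℝ) / (S.card : ℝ)

/-- The vertex set of a complex. -/
def verts (C : Finset (Finset ℕ)) : Finset ℕ := C.sup id

/-- The unrooted vertices of `T_r`: all vertices except the simplex root `σ_0` and the
vertex roots. -/
def unrooted (d Q r : ℕ) : Finset ℕ :=
  verts (Tr d Q r) \ (sigmaB d 0 ∪ rootSet d Q r)

theorem mem_sigmaB {d t x : ℕ} : x ∈ sigmaB d t ↔ t * d + 1 ≤ x ∧ x ≤ t * d + d := by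
  unfold sigmaB
  rw [Finset.mem_Icc, Nat.add_mul, Nat.one_mul]

theorem target_le {Q r k : ℕ} (hQ : 1 ≤ Q) : target Q r k ≤ Q := by
  unfold target
  split_ifs with h
  · have hb : 0 < r % Q := by omega
    have h1 : (k + 1) * Q ≤ (r % Q) * Q := Nat.mul_le_mul_right Q h
    rw [← Nat.lt_succ_iff, Nat.div_lt_iff_lt_mul hb, Nat.succ_mul Q (r % Q)]
    rw [Nat.mul_comm (r % Q) Q] at h1
    omega
  · have := Nat.mod_lt (k - r % Q) (show 0 < Q by omega)
    omega

theorem mem_Tr {d Q r : ℕ} {σ : Finset ℕ} : σ ∈ Tr d Q r ↔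
    (σ ⊆ Finset.Icc 1 (d * (Q + 1)) ∧ σ.Nonempty ∧ ∀ a ∈ σ, ∀ b ∈ σ, a ≤ b + d) ∨
    ∃ k < r, ∃ τ ⊆ sigmaB d (target Q r k), insert (rootVtx d Q k) τ = σ := by
  simp only [Tr, T0, Finset.mem_union, Finset.mem_filter, Finset.mem_powerset,
    Finset.mem_biUnion, Finset.mem_range, Finset.mem_image]

theorem block_le {d Q t : ℕ} (h : t ≤ Q) : t * d + d ≤ d * (Q + 1) := by
  have := Nat.mul_le_mul_right d h
  rw [Nat.mul_add, Nat.mul_comm d Q]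
  omega

theorem unrooted_eq {d Q r : ℕ} (hQ : 1 ≤ Q) :
    unrooted d Q r = Finset.Icc (d + 1) (d * (Q + 1)) := by
  ext x
  simp only [unrooted, verts, Finset.mem_sdiff, Finset.mem_sup, id, Finset.mem_union,
    mem_sigmaB, Finset.mem_Icc, rootSet, Finset.mem_image, Finset.mem_range]
  constructor
  · rintro ⟨⟨σ, hσ, hx⟩, hn⟩
    push Not at hn
    obtain ⟨h0, h1⟩ := hn
    rcases mem_Tr.1 hσ with ⟨h, -, -⟩ | ⟨k, hk, τ, hτ, rfl⟩
    · have := Finset.mem_Icc.1 (h hx)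
      omega
    · rcases Finset.mem_insert.1 hx with h | h
      · exact absurd h.symm (h1 k hk)
      · have h2 := mem_sigmaB.1 (hτ h)
        have h3 := block_le (d := d) (target_le (r := r) (k := k) hQ)
        omega
  · rintro ⟨h1, h2⟩
    refine ⟨⟨{x}, mem_Tr.2 (Or.inl ⟨?_, by simp, by simp⟩), by simp⟩, ?_⟩
    · simp; omega
    · rintro (h | ⟨k, hk, h⟩)
      · omega
      · unfold rootVtx at h; omega

theorem exists_block {d Q x : ℕ} (hd : 1 ≤ d) (hx : x ∈ Finset.Icc (d + 1) (d * (Q + 1))) :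
    ∃ t, 1 ≤ t ∧ t ≤ Q ∧ x ∈ sigmaB d t := by
  rw [Finset.mem_Icc] at hx
  refine ⟨(x - 1) / d, ?_, ?_, ?_⟩
  · rw [Nat.le_div_iff_mul_le hd]; omega
  · rw [← Nat.lt_succ_iff, Nat.div_lt_iff_lt_mul hd, Nat.succ_eq_add_one, Nat.mul_comm]; omega
  · rw [mem_sigmaB]
    have h1 := Nat.div_add_mod (x - 1) d
    have h2 := Nat.mod_lt (x - 1) hd
    rw [Nat.mul_comm] at h1
    omega

theorem block_subset {d Q t : ℕ} (h1 : 1 ≤ t) (h2 : t ≤ Q) :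
    sigmaB d t ⊆ Finset.Icc (d + 1) (d * (Q + 1)) := by
  intro x hx
  rw [mem_sigmaB] at hx
  have := block_le (d := d) h2
  have := Nat.mul_le_mul_right d h1
  rw [Finset.mem_Icc]
  omega

/-- Number of simplices containing `v` and avoiding `S`. -/
def marg (C : Finset (Finset ℕ)) (v : ℕ) (S : Finset ℕ) : ℕ :=
  (C.filter (fun σ => v ∈ σ ∧ Disjoint σ S)).card

theorem eCount_insert (C : Finset (Finset ℕ)) (v : ℕ) (S : Finset ℕ) :
    eCount C (insert v S) = eCount C S + marg C v S := by
  unfold eCount marg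
  rw [← Finset.card_union_of_disjoint]
  · congr 1
    ext σ
    simp only [Finset.mem_filter, Finset.mem_union, Finset.disjoint_iff_inter_eq_empty,
      ← Finset.not_nonempty_iff_eq_empty]
    by_cases hv : v ∈ σ
    · have : σ.Nonempty := ⟨v, hv⟩
      simp [hv, Finset.inter_insert_of_mem, this]
      rw [← and_or_left, ← Finset.not_nonempty_iff_eq_empty]
      exact (and_iff_left (em _)).symm
    · simp [hv, Finset.inter_insert_of_notMem]
  · rw [Finset.disjoint_left]
    intro σ h1 h2
    simp only [Finset.mem_filter, Finset.disjoint_iff_inter_eq_empty] at h1 h2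
    rw [h2.2.2] at h1
    simp at h1

theorem marg_le {d Q r a b p : ℕ} {S : Finset ℕ} (hd : 1 ≤ d)
    (ha : a ∈ Finset.Icc (d + 1) (d * (Q + 1)))
    (hbU : b ∈ Finset.Icc (d + 1) (d * (Q + 1))) (haS : a ∈ S)
    (hp : (b = a + 1 ∧ p = b + d) ∨ (a = b + 1 ∧ b = p + d))
    (hblock : ∀ t, b ∈ sigmaB d t → a ∈ sigmaB d t) :
    marg (Tr d Q r) b S ≤ marg (Tr d Q r) a (S.erase a) := by
  classical
  rw [Finset.mem_Icc] at ha hbU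
  unfold marg
  apply Finset.card_le_card_of_injOn
    (fun σ => if p ∈ σ ∧ p ≤ d * (Q + 1) then insert a (σ.erase p) else insert a (σ.erase b))
  · intro σ hσ
    simp only [Finset.coe_filter, Set.mem_ofPred_eq] at hσ ⊢
    obtain ⟨hC, hb, hdis⟩ := hσ
    have hsub : ∀ q, Disjoint (insert a (σ.erase q)) (S.erase a) := by
      intro q
      rw [Finset.disjoint_left] at hdis ⊢
      intro x hx hx'
      rw [Finset.mem_erase] at hx'
      rcases Finset.mem_insert.1 hx with h | h
      · exact hx'.1 h
      · exact hdis (Finset.mem_of_mem_erase h) hx'.2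
    refine ⟨?_, ?_, ?_⟩
    · rcases mem_Tr.1 hC with ⟨h1, h2, h3⟩ | ⟨k, hk, τ, hτ, rfl⟩
      · have main : ∀ q, (∀ x ∈ σ, x ≠ q → a ≤ x + d ∧ x ≤ a + d) →
            insert a (σ.erase q) ∈ Tr d Q r := by
          intro q hq
          refine mem_Tr.2 (Or.inl ⟨?_, by simp, ?_⟩)
          · intro x hx
            rcases Finset.mem_insert.1 hx with h | h
            · rw [Finset.mem_Icc]; omega
            · exact h1 (Finset.mem_of_mem_erase h)
          · intro x hx y hy
            rcases Finset.mem_insert.1 hx with h | h <;> rcases Finset.mem_insert.1 hy with h' | h'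
            · omega
            · rw [Finset.mem_erase] at h'
              have := hq y h'.2 h'.1
              omega
            · rw [Finset.mem_erase] at h
              have := hq x h.2 h.1
              omega
            · exact h3 x (Finset.mem_of_mem_erase h) y (Finset.mem_of_mem_erase h')
        split_ifs with hpσ
        · apply main
          intro x hx hxp
          have e1 := h3 x hx b hb
          have e2 := h3 b hb x hx
          have e3 := h3 x hx p hpσ.1
          have e4 := h3 p hpσ.1 x hx
          omega
        · apply main
          intro x hx hxb
          have e1 := h3 x hx b hb
          have e2 := h3 b hb x hx
          have e3 := Finset.mem_Icc.1 (h1 hx)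
          have e4 : x ≠ p := by
            rintro rfl
            exact hpσ ⟨hx, e3.2⟩
          omega
      · have hbroot : rootVtx d Q k ≠ b := by
          unfold rootVtx; omega
        have hbτ : b ∈ τ := by
          rcases Finset.mem_insert.1 hb with h | h
          · exact absurd h.symm hbroot
          · exact h
        have hbB := mem_sigmaB.1 (hτ hbτ)
        have haB := hblock _ (hτ hbτ)
        have hnp : ¬ (p ∈ insert (rootVtx d Q k) τ ∧ p ≤ d * (Q + 1)) := by
          rintro ⟨h, h'⟩
          rcases Finset.mem_insert.1 h with h | h
          · unfold rootVtx at h; omega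
          · have := mem_sigmaB.1 (hτ h)
            omega
        rw [if_neg hnp]
        refine mem_Tr.2 (Or.inr ⟨k, hk, insert a (τ.erase b), ?_, ?_⟩)
        · intro x hx
          rcases Finset.mem_insert.1 hx with h | h
          · rwa [h]
          · exact hτ (Finset.mem_of_mem_erase h)
        · rw [Finset.insert_comm, Finset.erase_insert_of_ne hbroot]
    · split_ifs <;> simp
    · split_ifs <;> exact hsub _
  · intro σ hσ σ' hσ' heq
    simp only [Finset.coe_filter, Set.mem_ofPred_eq] at hσ hσ'
    obtain ⟨-, hb, hdis⟩ := hσ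
    obtain ⟨-, hb', hdis'⟩ := hσ'
    have ha1 : a ∉ σ := fun h => Finset.disjoint_left.1 hdis h haS
    have ha2 : a ∉ σ' := fun h => Finset.disjoint_left.1 hdis' h haS
    have hab : b ≠ a := by omega
    have hbp : b ≠ p := by omega
    have key : ∀ q, q ∈ σ → q ∈ σ' → insert a (σ.erase q) = insert a (σ'.erase q) → σ = σ' := by
      intro q h1 h2 h
      have h3 := congrArg (fun s => Finset.erase s a) h
      beta_reduce at h3
      rw [Finset.erase_insert (fun h => ha1 (Finset.mem_of_mem_erase h)),
        Finset.erase_insert (fun h => ha2 (Finset.mem_of_mem_erase h))] at h3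
      rw [← Finset.insert_erase h1, ← Finset.insert_erase h2, h3]
    simp only at heq
    split_ifs at heq with h1 h2 h2
    · exact key p h1.1 h2.1 heq
    · exfalso
      have : b ∈ insert a (σ'.erase b) := by
        rw [← heq]; simp [hb, hbp]
      simp [hab] at this
    · exfalso
      have : b ∈ insert a (σ.erase b) := by
        rw [heq]; simp [hb', hbp]
      simp [hab] at this
    · exact key b hb hb' heq

theorem eCount_split {d Q r B : ℕ} {L R : Finset ℕ}
    (hL : ∀ x ∈ L, x ≤ B) (hR : ∀ x ∈ R, B + d < x ∧ x ≤ d * (Q + 1)) (hd : 1 ≤ d) :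
    eCount (Tr d Q r) (L ∪ R) = eCount (Tr d Q r) L + eCount (Tr d Q r) R := by
  unfold eCount
  rw [← Finset.card_union_of_disjoint]
  · congr 1
    ext σ
    simp only [Finset.mem_filter, Finset.mem_union, Finset.inter_union_distrib_left,
      Finset.union_nonempty]
    tauto
  · rw [Finset.disjoint_left]
    intro σ h1 h2
    simp only [Finset.mem_filter] at h1 h2
    obtain ⟨hC, -, x, hx⟩ := h1
    obtain ⟨-, -, y, hy⟩ := h2
    rw [Finset.mem_inter] at hx hy
    have e1 := hL x hx.2
    have e2 := hR y hy.2
    rcases mem_Tr.1 hC with ⟨-, -, h3⟩ | ⟨k, hk, τ, hτ, rfl⟩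
    · have := h3 y hy.1 x hx.1
      omega
    · have aux : ∀ z ∈ insert (rootVtx d Q k) τ, z ≤ d * (Q + 1) →
          z ∈ sigmaB d (target Q r k) := by
        intro z hz hz'
        rcases Finset.mem_insert.1 hz with h | h
        · unfold rootVtx at h; omega
        · exact hτ h
      have f1 := mem_sigmaB.1 (aux x hx.1 (by omega))
      have f2 := mem_sigmaB.1 (aux y hy.1 (by omega))
      omega

theorem block_closed {d t : ℕ} {S : Finset ℕ}
    (hS : ∀ a b, a ∈ S → a ∈ sigmaB d t → b ∈ sigmaB d t → (b = a + 1 ∨ a = b + 1) → b ∈ S)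
    {x : ℕ} (hx : x ∈ S) (hxt : x ∈ sigmaB d t) : sigmaB d t ⊆ S := by
  have up : ∀ n, x + n ∈ sigmaB d t → x + n ∈ S := by
    intro n
    induction n with
    | zero => intro _; exact hx
    | succ n ih =>
      intro h
      have h' : x + n ∈ sigmaB d t := by
        rw [mem_sigmaB] at *; omega
      exact hS (x + n) _ (ih h') h' h (Or.inl rfl)
  have down : ∀ n, n ≤ x → x - n ∈ sigmaB d t → x - n ∈ S := by
    intro n
    induction n with
    | zero => intro _ _; exact hx
    | succ n ih =>
      intro hn h
      have h' : x - n ∈ sigmaB d t := by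
        rw [mem_sigmaB] at *; omega
      exact hS (x - n) _ (ih (by omega) h') h' h (Or.inr (by omega))
  intro y hy
  rcases le_total x y with h | h
  · have := up (y - x)
    rw [Nat.add_sub_cancel' h] at this
    exact this hy
  · have := down (x - y) (by omega)
    rw [Nat.sub_sub_self h] at this
    exact this hy

/-- **Lemma (nice minimizers).** For all integers `d, Q ≥ 1` and `r ≥ 0`, there exist
`1 ≤ i ≤ j ≤ Q` such that `mindens(T_r) = dens_{T_r}(σ_i ∪ σ_{i+1} ∪ … ∪ σ_j)`:
the set `σ_i ∪ … ∪ σ_j` consists of unrooted vertices and its density is minimal among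
all nonempty sets of unrooted vertices. -/
theorem Tr_mindens_on_interval (d Q r : ℕ) (hd : 1 ≤ d) (hQ : 1 ≤ Q) :
    ∃ i j : ℕ, 1 ≤ i ∧ i ≤ j ∧ j ≤ Q ∧
      (Finset.Icc i j).biUnion (sigmaB d) ⊆ unrooted d Q r ∧
      ∀ S ⊆ unrooted d Q r, S.Nonempty →
        dens (Tr d Q r) ((Finset.Icc i j).biUnion (sigmaB d)) ≤ dens (Tr d Q r) S := by
  classical
  rw [unrooted_eq hQ]
  set U := Finset.Icc (d + 1) (d * (Q + 1)) with hU
  set C := Tr d Q r with hC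
  have hUne : U.Nonempty := by
    refine ⟨d + 1, block_subset le_rfl hQ (mem_sigmaB.2 ?_)⟩
    omega
  -- the minimal density
  obtain ⟨S₀, hS₀, hmin⟩ := Finset.exists_min_image
    (U.powerset.filter (fun S => S.Nonempty)) (dens C)
    ⟨U, by simp [hUne]⟩
  set l := dens C S₀ with hl
  have hge : ∀ S ⊆ U, l * S.card ≤ eCount C S := by
    intro S hS
    rcases S.eq_empty_or_nonempty with rfl | hne
    · simp
    · have h1 := hmin S (by simp [hS, hne])
      have h2 : (0 : ℝ) < S.card := by exact_mod_cast hne.card_pos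
      unfold dens at h1
      rwa [le_div_iff₀ h2] at h1
  obtain ⟨S, hSM, hmax⟩ := Finset.exists_max_image
    (U.powerset.filter (fun S => S.Nonempty ∧ (eCount C S : ℝ) ≤ l * S.card)) Finset.card
    ⟨S₀, by
      simp only [Finset.mem_filter, Finset.mem_powerset] at hS₀ ⊢
      refine ⟨hS₀.1, hS₀.2, le_of_eq ?_⟩
      have h2 : (S₀.card : ℝ) ≠ 0 := by exact_mod_cast hS₀.2.card_pos.ne'
      rw [hl, dens, div_mul_cancel₀ _ h2]⟩
  simp only [Finset.mem_filter, Finset.mem_powerset] at hSM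
  obtain ⟨hSU, hSne, hSle⟩ := hSM
  have hclosed : ∀ t, ∀ a b, a ∈ S → a ∈ sigmaB d t → b ∈ sigmaB d t →
      (b = a + 1 ∨ a = b + 1) → b ∈ S := by
    intro t a b haS hat hbt hab
    by_contra hbS
    have haU := hSU haS
    obtain ⟨t', ht1, ht2, hat'⟩ := exists_block hd haU
    have same : ∀ u v x, x ∈ sigmaB d u → x ∈ sigmaB d v → u = v := by
      intro u v x h1 h2
      rw [mem_sigmaB] at h1 h2
      rcases lt_trichotomy u v with h | h | h
      · have := Nat.mul_le_mul_right d (Nat.succ_le_of_lt h)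
        rw [Nat.succ_mul] at this
        omega
      · exact h
      · have := Nat.mul_le_mul_right d (Nat.succ_le_of_lt h)
        rw [Nat.succ_mul] at this
        omega
    obtain rfl := same _ _ _ hat hat'
    have hbU : b ∈ U := block_subset ht1 ht2 hbt
    have hbl : ∀ u, b ∈ sigmaB d u → a ∈ sigmaB d u := by
      intro u hu
      rw [same _ _ _ hu hbt]
      exact hat
    have hbU' := Finset.mem_Icc.1 hbU
    have hm : marg C b S ≤ marg C a (S.erase a) := by
      rcases hab with h | h
      · exact marg_le (p := b + d) hd haU hbU haS (Or.inl ⟨h, rfl⟩) hbl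
      · exact marg_le (p := b - d) hd haU hbU haS (Or.inr ⟨h, by omega⟩) hbl
    have e1 := eCount_insert C b S
    have e2 := eCount_insert C a (S.erase a)
    rw [Finset.insert_erase haS] at e2
    have e3 := hge (S.erase a) ((Finset.erase_subset _ _).trans hSU)
    have e4 := Finset.card_erase_add_one haS
    have e5 := Finset.card_insert_of_notMem hbS
    have e6 := hmax (insert b S) (by
      simp only [Finset.mem_filter, Finset.mem_powerset]
      refine ⟨Finset.insert_subset hbU hSU, by simp, ?_⟩
      rw [e1, e5]
      have e2' : (eCount C S : ℝ) = eCount C (S.erase a) + marg C a (S.erase a) := by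
        exact_mod_cast e2
      have e4' : ((S.erase a).card : ℝ) + 1 = S.card := by exact_mod_cast e4
      have hm' : (marg C b S : ℝ) ≤ marg C a (S.erase a) := by exact_mod_cast hm
      push_cast
      rw [← e4'] at hSle ⊢
      nlinarith)
    omega
  have hblk : ∀ x ∈ S, ∃ t, 1 ≤ t ∧ t ≤ Q ∧ x ∈ sigmaB d t ∧ sigmaB d t ⊆ S := by
    intro x hx
    obtain ⟨t, h1, h2, h3⟩ := exists_block hd (hSU hx)
    exact ⟨t, h1, h2, h3, block_closed (hclosed t) hx h3⟩
  set J := (Finset.Icc 1 Q).filter (fun t => sigmaB d t ⊆ S) with hJ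
  have memJ : ∀ t, t ∈ J ↔ (1 ≤ t ∧ t ≤ Q) ∧ sigmaB d t ⊆ S := by
    intro t; rw [hJ, Finset.mem_filter, Finset.mem_Icc]
  have hJne : J.Nonempty := by
    obtain ⟨x, hx⟩ := hSne
    obtain ⟨t, h1, h2, h3, h4⟩ := hblk x hx
    exact ⟨t, (memJ t).2 ⟨⟨h1, h2⟩, h4⟩⟩
  obtain ⟨i, hiJ, himin⟩ := Finset.exists_min_image J id hJne
  simp only [id] at himin
  obtain ⟨⟨hi1, hiQ⟩, hiS⟩ := (memJ i).1 hiJ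
  obtain ⟨j, hjK, hjmax⟩ := Finset.exists_max_image
    ((Finset.Icc i Q).filter (fun j => ∀ t ∈ Finset.Icc i j, t ∈ J)) id
    ⟨i, by
      simp only [Finset.mem_filter, Finset.mem_Icc]
      refine ⟨⟨le_rfl, hiQ⟩, fun t ht => ?_⟩
      rwa [le_antisymm ht.2 ht.1]⟩
  simp only [id, Finset.mem_filter, Finset.mem_Icc] at hjK hjmax
  obtain ⟨⟨hij, hjQ⟩, hjJ⟩ := hjK
  have hj1 : j + 1 ∉ J := by
    intro h
    have := hjmax (j + 1) ⟨⟨by omega, ((memJ _).1 h).1.2⟩, by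
      intro t ht
      rcases Nat.lt_or_ge j t with h' | h'
      · have : t = j + 1 := by omega
        rwa [this]
      · exact hjJ t ⟨ht.1, h'⟩⟩
    omega
  set L := (Finset.Icc i j).biUnion (sigmaB d) with hL
  have hLS : L ⊆ S := by
    intro x hx
    rw [hL, Finset.mem_biUnion] at hx
    obtain ⟨t, ht, hx⟩ := hx
    exact ((memJ t).1 (hjJ t (Finset.mem_Icc.1 ht))).2 hx
  have hLne : L.Nonempty := by
    refine ⟨i * d + 1, Finset.mem_biUnion.2 ⟨i, by simp [hij], mem_sigmaB.2 ?_⟩⟩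
    omega
  refine ⟨i, j, hi1, hij, hjQ, hLS.trans hSU, ?_⟩
  have hsplit : eCount C (L ∪ (S \ L)) = eCount C L + eCount C (S \ L) := by
    apply eCount_split (B := j * d + d) _ _ hd
    · intro x hx
      rw [hL, Finset.mem_biUnion] at hx
      obtain ⟨t, ht, hx⟩ := hx
      have h1 := mem_sigmaB.1 hx
      have h2 := Nat.mul_le_mul_right d (Finset.mem_Icc.1 ht).2
      omega
    · intro x hx
      rw [Finset.mem_sdiff] at hx
      refine ⟨?_, (Finset.mem_Icc.1 (hSU hx.1)).2⟩
      obtain ⟨t, h1, h2, h3, h4⟩ := hblk x hx.1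
      have htJ : t ∈ J := (memJ t).2 ⟨⟨h1, h2⟩, h4⟩
      have hit := himin t htJ
      have hne : t ≠ j + 1 := by
        rintro rfl
        exact hj1 htJ
      have hjt : ¬ t ≤ j := by
        intro h
        exact hx.2 (Finset.mem_biUnion.2 ⟨t, Finset.mem_Icc.2 ⟨hit, h⟩, h3⟩)
      have h5 : j + 2 ≤ t := by omega
      have h6 := Nat.mul_le_mul_right d h5
      rw [Nat.add_mul] at h6
      have h7 := mem_sigmaB.1 h3
      omega
  rw [Finset.union_sdiff_of_subset hLS] at hsplit
  have hcard := Finset.card_sdiff_add_card_eq_card hLS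
  have hR := hge (S \ L) (Finset.sdiff_subset.trans hSU)
  have hcL : (0 : ℝ) < L.card := by exact_mod_cast hLne.card_pos
  have hLle : dens C L ≤ l := by
    unfold dens
    rw [div_le_iff₀ hcL]
    have e1 : (eCount C S : ℝ) = eCount C L + eCount C (S \ L) := by exact_mod_cast hsplit
    have e2 : ((S \ L).card : ℝ) + L.card = S.card := by exact_mod_cast hcard
    rw [← e2] at hSle
    nlinarith
  intro S' hS' hne'
  exact hLle.trans (hmin S' (by simp [hS', hne']))
end
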